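/- arXiv:2108.01732 — 2 statements merged into one kernel-verified Lean document; each statement's English description precedes it below -/
import Mathlib

section
/- Let n ≥ 3, let K ⊂ ℝ^n be a strictly convex body, and let L ⊂ ℝ^n be the image of a topological embedding of the sphere S^{n−1} such that K is contained in a bounded connected component of ℝ^n \ L (in particular L ∩ K = ∅). Suppose that for every x ∈ L there exist a point y ∈ L with y ≠ x and a vector p ∈ ℝ^n such that C_y = p + C_x. Then there exists a point c ∈ ℝ^n such that K = 2c − K and L = 2c − L; that is, K and L are centrally symmetric with common center c. -/
open Set Metric RealInnerProductSpace

noncomputable section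

/-- Euclidean space ℝ^n. -/
abbrev Euc (n : ℕ) := EuclideanSpace ℝ (Fin n)

/-- The solid double-cone generated by a convex body `K` and a point `x`:
the union of all lines through `x` and a point of `K`. -/
def solidCone {n : ℕ} (K : Set (Euc n)) (x : Euc n) : Set (Euc n) :=
  ⋃ y ∈ K, (affineSpan ℝ ({x, y} : Set (Euc n)) : Set (Euc n))

/-- The support double-cone of `K` with apex `x`: the topological frontier of
the solid double-cone. -/
def supportCone {n : ℕ} (K : Set (Euc n)) (x : Euc n) : Set (Euc n) :=
  frontier (solidCone K x)

/-- A convex body: a compact convex set with nonempty interior. -/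
def IsConvexBody {n : ℕ} (K : Set (Euc n)) : Prop :=
  IsCompact K ∧ Convex ℝ K ∧ (interior K).Nonempty

/-- `M` is the image of a topological embedding of the sphere `S^m ⊆ ℝ^(m+1)`
into ℝ^n: a continuous injective map from the unit sphere with range `M`
(such a map from the compact sphere is automatically a homeomorphism onto its
image). -/
def IsSphereEmbeddingImage {n : ℕ} (m : ℕ) (M : Set (Euc n)) : Prop :=
  ∃ f : Metric.sphere (0 : Euc (m + 1)) 1 → Euc n,
    Continuous f ∧ Function.Injective f ∧ Set.range f = M

set_option linter.unusedSectionVars false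

section Aux

variable {E : Type*} [NormedAddCommGroup E] [InnerProductSpace ℝ E] [FiniteDimensional ℝ E]

lemma exists_orth (h3 : 3 ≤ Module.finrank ℝ E) (a b : E) :
    ∃ z : E, z ≠ 0 ∧ ⟪a, z⟫ = 0 ∧ ⟪b, z⟫ = 0 := by
  classical
  have h1 := Submodule.finrank_add_finrank_orthogonal (𝕜 := ℝ) (Submodule.span ℝ ({a, b} : Set E))
  have h2 : Module.finrank ℝ (Submodule.span ℝ ({a, b} : Set E)) ≤ 2 := by
    have := finrank_span_finset_le_card (R := ℝ) ({a, b} : Finset E)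
    have h4 : ({a, b} : Finset E).card ≤ 2 := Finset.card_le_two
    have e : ((({a, b} : Finset E)) : Set E) = {a, b} := by simp
    rw [e] at this
    simp only [Set.finrank] at this
    omega
  have h5 : (Submodule.span ℝ ({a, b} : Set E))ᗮ ≠ ⊥ := by
    intro h
    rw [h, finrank_bot] at h1
    omega
  obtain ⟨z, hz, hz0⟩ := Submodule.exists_mem_ne_zero_of_ne_bot h5
  rw [Submodule.mem_orthogonal] at hz
  exact ⟨z, hz0, hz a (Submodule.subset_span (by simp)), hz b (Submodule.subset_span (by simp))⟩

/-- support function -/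
def supf (K : Set E) (v : E) : ℝ := sSup ((fun k => ⟪v, k⟫) '' K)

lemma supf_cont {K : Set E} (hK : IsCompact K) : Continuous (supf K) := by
  have := IsCompact.continuous_sSup (f := fun (v k : E) => ⟪v, k⟫) hK (by
    simp only [Function.HasUncurry.uncurry, id]
    fun_prop)
  exact this

lemma supf_ge {K : Set E} (hK : IsCompact K) (v : E) {k : E} (hk : k ∈ K) : ⟪v, k⟫ ≤ supf K v := by
  apply le_csSup
  · exact (hK.image (by fun_prop)).bddAbove
  · exact ⟨k, hk, rfl⟩

lemma supf_att {K : Set E} (hK : IsCompact K) (hne : K.Nonempty) (v : E) :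
    ∃ k ∈ K, ⟪v, k⟫ = supf K v := by
  have := (hK.image (f := fun k => ⟪v, k⟫) (by fun_prop)).sSup_mem (hne.image _)
  exact this

lemma supf_width {K : Set E} (hK : IsCompact K) (hi : (interior K).Nonempty) {v : E} (hv : v ≠ 0) :
    0 < supf K v + supf K (-v) := by
  obtain ⟨a, ha⟩ := hi
  have hc : Filter.Tendsto (fun t : ℝ => a + t • v) (nhdsWithin 0 (Ioi 0)) (nhds a) := by
    have : Continuous (fun t : ℝ => a + t • v) := by fun_prop
    have := this.tendsto 0
    simp only [zero_smul, add_zero] at this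
    exact this.mono_left nhdsWithin_le_nhds
  have := hc.eventually (mem_interior_iff_mem_nhds.1 ha)
  obtain ⟨t, ht, ht0⟩ := (this.and self_mem_nhdsWithin).exists
  have ht0 : 0 < t := ht0
  have h1 := supf_ge hK v (show a + t • v ∈ K from ht)
  have h2 := supf_ge hK (-v) (interior_subset ha)
  rw [inner_add_right, inner_smul_right] at h1
  rw [inner_neg_left] at h2
  have h3 : 0 < t * ⟪v, v⟫ := mul_pos ht0 (real_inner_self_pos.2 hv)
  linarith

lemma sep_line {K : Set E} (hK : IsCompact K) (hne : K.Nonempty) (hc : Convex ℝ K) (x d : E)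
    (hd : ∀ t : ℝ, x + t • d ∉ K) : ∃ v : E, ⟪v, d⟫ = 0 ∧ supf K v < ⟪v, x⟫ := by
  have hconv : Convex ℝ (AffineSubspace.mk' x (ℝ ∙ d) : Set E) := AffineSubspace.convex _
  have hclosed : IsClosed (AffineSubspace.mk' x (ℝ ∙ d) : Set E) :=
    AffineSubspace.closed_of_finiteDimensional _
  have hmem : ∀ t : ℝ, x + t • d ∈ (AffineSubspace.mk' x (ℝ ∙ d) : Set E) := by
    intro t
    simp [AffineSubspace.mem_mk', Submodule.mem_span_singleton]
  have hdis : Disjoint K (AffineSubspace.mk' x (ℝ ∙ d) : Set E) := by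
    rw [Set.disjoint_left]
    intro z hz hz2
    simp only [SetLike.mem_coe, AffineSubspace.mem_mk', Submodule.mem_span_singleton,
      vsub_eq_sub] at hz2
    obtain ⟨t, ht⟩ := hz2
    apply hd t
    rw [ht]; simpa using hz
  obtain ⟨f, r, s, h1, h2, h3⟩ := geometric_hahn_banach_compact_closed hc hK hconv hclosed hdis
  have hf : ∀ z, f z = ⟪(InnerProductSpace.toDual ℝ E).symm f, z⟫ := by
    intro z; rw [InnerProductSpace.toDual_symm_apply]
  refine ⟨(InnerProductSpace.toDual ℝ E).symm f, ?_, ?_⟩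
  · rw [← hf]
    by_contra hne
    have := h3 _ (hmem ((s - f x - 1) / f d))
    rw [map_add, map_smul, smul_eq_mul, div_mul_cancel₀ _ hne] at this
    linarith
  · obtain ⟨k, hk, hk2⟩ := supf_att hK hne ((InnerProductSpace.toDual ℝ E).symm f)
    rw [← hk2, ← hf, ← hf]
    have := h3 _ (hmem 0)
    have := h1 k hk
    simp at *
    linarith

lemma span_lemma (h3 : 3 ≤ Module.finrank ℝ E) {K : Set E} (hK : IsCompact K)
    (hc : Convex ℝ K) (hi : (interior K).Nonempty) (x d w : E)
    (hd : ∀ t : ℝ, x + t • d ∉ K) (hw : ∀ c : ℝ, w ≠ c • d) :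
    ∃ v : E, ⟪v, d⟫ = 0 ∧ ⟪v, x⟫ = supf K v ∧ ⟪v, w⟫ ≠ 0 := by
  by_contra! hcon
  have hne : K.Nonempty := hi.mono interior_subset
  set f : E → ℝ := fun v => supf K v - ⟪v, x⟫ with hf
  have hfc : Continuous f := (supf_cont hK).sub (by fun_prop)
  -- component of w orthogonal to d
  obtain ⟨w', hw'd, hw'w⟩ : ∃ w' : E, ⟪w', d⟫ = 0 ∧ 0 < ⟪w', w⟫ := by
    by_cases h0 : d = 0
    · refine ⟨w, by simp [h0], real_inner_self_pos.2 ?_⟩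
      intro h; exact hw 0 (by simp [h])
    · have hdd : (0:ℝ) < ⟪d, d⟫ := real_inner_self_pos.2 h0
      have e1 : ⟪w - (⟪w, d⟫ / ⟪d, d⟫) • d, d⟫ = 0 := by
        rw [inner_sub_left, real_inner_smul_left, div_mul_cancel₀ _ hdd.ne', sub_self]
      refine ⟨w - (⟪w, d⟫ / ⟪d, d⟫) • d, e1, ?_⟩
      have e2 : w - (⟪w, d⟫ / ⟪d, d⟫) • d ≠ 0 := by
        intro h; exact hw _ (sub_eq_zero.1 h)
      have e3 := real_inner_self_pos.2 e2
      rw [inner_sub_right, real_inner_smul_right, e1] at e3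
      simpa using e3
  -- key : for sign s, f > 0 on the half space
  have key : ∀ s : ℝ, s ≠ 0 → ∀ v : E, ⟪v, d⟫ = 0 → 0 < s * ⟪v, w⟫ → 0 < f v := by
    intro s hs v hvd hvw
    by_contra! hneg
    have hA : IsPreconnected {v : E | ⟪v, d⟫ = 0 ∧ 0 < s * ⟪v, w⟫} := by
      apply Convex.isPreconnected
      intro a ha b hb p q hp hq hpq
      simp only [mem_ofPred_eq, inner_add_left, real_inner_smul_left] at *
      refine ⟨by rw [ha.1, hb.1]; simp, ?_⟩
      have e : s * (p * ⟪a, w⟫ + q * ⟪b, w⟫) = p * (s * ⟪a, w⟫) + q * (s * ⟪b, w⟫) := by ring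
      rw [e]
      rcases eq_or_lt_of_le hp with h | h
      · have : q = 1 := by linarith
        rw [← h, this]; linarith [hb.2]
      · have := mul_pos h ha.2
        have := mul_nonneg hq hb.2.le
        linarith
    have hall : ∀ v' : E, ⟪v', d⟫ = 0 → 0 < s * ⟪v', w⟫ → f v' < 0 := by
      intro v' h1 h2
      by_contra! hpos
      obtain ⟨y, hy, hy2⟩ := hA.intermediate_value₂ (a := v) (b := v') (f := f) (g := fun _ => 0)
        ⟨hvd, hvw⟩ ⟨h1, h2⟩ hfc.continuousOn continuousOn_const hneg hpos
      have := hcon y hy.1 (by simp only [hf] at hy2; linarith)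
      have := hy.2
      simp_all
    obtain ⟨z, hz0, hzd, hzw⟩ := exists_orth h3 d w
    have hz : ∀ z : E, ⟪d, z⟫ = 0 → ⟪w, z⟫ = 0 → f z ≤ 0 := by
      intro z hzd hzw
      have hcz : Filter.Tendsto (fun t : ℝ => f (z + t • v)) (nhdsWithin 0 (Ioi 0)) (nhds (f z)) := by
        have : Continuous (fun t : ℝ => f (z + t • v)) := by fun_prop
        have := this.tendsto 0
        simp only [zero_smul, add_zero] at this
        exact this.mono_left nhdsWithin_le_nhds
      refine le_of_tendsto hcz ?_
      filter_upwards [self_mem_nhdsWithin] with t ht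
      have ht : 0 < t := ht
      refine (hall _ ?_ ?_).le
      · rw [inner_add_left, real_inner_smul_left, hvd, real_inner_comm, hzd]; simp
      · rw [inner_add_left, real_inner_smul_left, real_inner_comm, hzw]
        have := mul_pos ht hvw
        linarith
    have e1 := hz z hzd hzw
    have e2 := hz (-z) (by simp [hzd]) (by simp [hzw])
    have e3 := supf_width hK hi hz0
    simp only [hf, inner_neg_left] at e1 e2
    linarith
  obtain ⟨v, hvd, hv⟩ := sep_line hK hne hc x d hd
  have hfv : f v < 0 := by simp only [hf]; linarith
  rcases lt_trichotomy ⟪v, w⟫ 0 with h | h | h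
  · have := key (-1) (by norm_num) v hvd (by linarith); linarith
  · have hcz : Filter.Tendsto (fun t : ℝ => f (v + t • w')) (nhdsWithin 0 (Ioi 0)) (nhds (f v)) := by
      have : Continuous (fun t : ℝ => f (v + t • w')) := by fun_prop
      have := this.tendsto 0
      simp only [zero_smul, add_zero] at this
      exact this.mono_left nhdsWithin_le_nhds
    have := ge_of_tendsto (b := 0) hcz (by
      filter_upwards [self_mem_nhdsWithin] with t ht
      have ht : 0 < t := ht
      refine (key 1 one_ne_zero _ ?_ ?_).le
      · rw [inner_add_left, real_inner_smul_left, hvd, hw'd]; simp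
      · rw [inner_add_left, real_inner_smul_left, h]
        have := mul_pos ht hw'w
        linarith)
    linarith
  · have := key (1) (by norm_num) v hvd (by linarith); linarith

section Homothety

lemma hom_direct {M : Set E} {ψ : E → E}
    (hψ : ∀ x ∈ M, ∀ y ∈ M, LinearIndependent ℝ ![x, y] → ∃ c : ℝ, ψ x - ψ y = c • (x - y))
    {b1 b2 x : E} (hb1 : b1 ∈ M) (hb2 : b2 ∈ M) (hx : x ∈ M) (h1 : ψ b1 = 0) (h2 : ψ b2 = 0)
    (hne : b1 ≠ b2)
    (i1 : LinearIndependent ℝ ![x, b1]) (i2 : LinearIndependent ℝ ![x, b2])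
    (hl : ∀ s : ℝ, x ≠ b1 + s • (b2 - b1)) : ψ x = 0 := by
  obtain ⟨c1, hc1⟩ := hψ x hx b1 hb1 i1
  obtain ⟨c2, hc2⟩ := hψ x hx b2 hb2 i2
  rw [h1, sub_zero] at hc1
  rw [h2, sub_zero] at hc2
  by_contra h0
  have hc10 : c1 ≠ 0 := by rintro rfl; simp at hc1; exact h0 hc1
  by_cases hcc : c1 = c2
  · subst hcc
    rw [hc1] at hc2
    have := smul_right_injective E hc10 hc2
    exact hne (by simpa using this)
  · have hcc' : c1 - c2 ≠ 0 := sub_ne_zero.2 hcc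
    apply hl (- c2 / (c1 - c2))
    have h := hc1.symm.trans hc2
    have h' : (c1 - c2) • x = (c1 - c2) • (b1 + (- c2 / (c1 - c2)) • (b2 - b1)) := by
      rw [smul_add, smul_smul, mul_div_cancel₀ _ hcc']
      have : c1 • x = c2 • x - c2 • b2 + c1 • b1 := by
        rw [smul_sub, smul_sub] at h
        rw [← h]; abel
      rw [sub_smul, this]
      module
    exact smul_right_injective E hcc' h'

set_option maxHeartbeats 1000000 in
lemma hom_two {M : Set E} {ψ : E → E}
    (hψ : ∀ x ∈ M, ∀ y ∈ M, LinearIndependent ℝ ![x, y] → ∃ c : ℝ, ψ x - ψ y = c • (x - y))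
    {e1 e2 x : E} (he : LinearIndependent ℝ ![e1, e2])
    (hM1 : ∃ t : ℝ, 0 < t ∧ t • (-((2:ℝ) • e1 + e2)) ∈ M)
    (hM2 : ∃ t : ℝ, 0 < t ∧ t • (-(e1 + (2:ℝ) • e2)) ∈ M)
    (hb1 : e1 ∈ M) (hb2 : e2 ∈ M) (hx : x ∈ M) (h1 : ψ e1 = 0) (h2 : ψ e2 = 0)
    (i1 : LinearIndependent ℝ ![x, e1]) (i2 : LinearIndependent ℝ ![x, e2]) : ψ x = 0 := by
  have he' := LinearIndependent.pair_iff.1 he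
  have hne : e1 ≠ e2 := by
    rintro h
    have := he' 1 (-1) (by rw [h]; module)
    simp at this
  by_cases hl : ∀ s : ℝ, x ≠ e1 + s • (e2 - e1)
  · exact hom_direct hψ hb1 hb2 hx h1 h2 hne i1 i2 hl
  push Not at hl
  obtain ⟨s, hs⟩ := hl
  -- general fourth point
  have gen : ∀ p q t : ℝ, 0 < p → 0 < q → 0 < t → t • (-(p • e1 + q • e2)) ∈ M →
      (1 - s) * q ≠ s * p → ψ x = 0 := by
    intro p q t hp hq ht hm hpq
    have hb4 : ψ (t • (-(p • e1 + q • e2))) = 0 := by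
      refine hom_direct hψ hb1 hb2 hm h1 h2 hne ?_ ?_ ?_
      · rw [LinearIndependent.pair_iff]
        intro a b hab
        have := he' (-(a * t * p) + b) (-(a * t * q)) (by rw [← hab]; module)
        have ha : a = 0 := by
          have := this.2
          by_contra h
          have h2 : a * t * q ≠ 0 := mul_ne_zero (mul_ne_zero h ht.ne') hq.ne'
          exact h2 (neg_eq_zero.1 this)
        subst ha
        refine ⟨rfl, by simpa using this.1⟩
      · rw [LinearIndependent.pair_iff]
        intro a b hab
        have := he' (-(a * t * p)) (-(a * t * q) + b) (by rw [← hab]; module)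
        have ha : a = 0 := by
          have := this.1
          by_contra h
          have h2 : a * t * p ≠ 0 := mul_ne_zero (mul_ne_zero h ht.ne') hp.ne'
          exact h2 (neg_eq_zero.1 this)
        subst ha
        refine ⟨rfl, by simpa using this.2⟩
      · intro r hr
        have := he' (t * p + (1 - r)) (t * q + r) (by
          have : t • (-(p • e1 + q • e2)) - (e1 + r • (e2 - e1)) = 0 := sub_eq_zero.2 hr
          rw [← neg_eq_zero, ← this]; module)
        have := mul_pos ht hp
        have := mul_pos ht hq
        linarith
    refine hom_direct hψ hb1 hm hx h1 hb4 ?_ i1 ?_ ?_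
    · intro hr
      have := he' (1 + t * p) (t * q) (by
          have : e1 - t • (-(p • e1 + q • e2)) = 0 := sub_eq_zero.2 hr
          rw [← this]; module)
      have := mul_pos ht hp
      linarith
    · rw [LinearIndependent.pair_iff]
      intro a b hab
      have := he' (a * (1 - s) - b * t * p) (a * s - b * t * q) (by rw [← hab, hs]; module)
      obtain ⟨g1, g2⟩ := this
      have ha : a = 0 := by
        have : a * ((1 - s) * q - s * p) = 0 := by linear_combination q * g1 - p * g2
        rcases mul_eq_zero.1 this with h | h
        · exact h
        · exact absurd (sub_eq_zero.1 h) hpq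
      subst ha
      refine ⟨rfl, ?_⟩
      have : b * (t * p) = 0 := by linarith
      rcases mul_eq_zero.1 this with h | h
      · exact h
      · have := mul_pos ht hp; linarith
    · intro r hr
      have := he' (1 - s - (1 - r) + r * t * p) (s + r * t * q) (by
          have : x - (e1 + r • (t • (-(p • e1 + q • e2)) - e1)) = 0 := sub_eq_zero.2 hr
          rw [← this, hs]; module)
      obtain ⟨g1, g2⟩ := this
      have g3 : r * (1 + t * p + t * q) = 0 := by linear_combination g1 + g2
      have : 0 < 1 + t * p + t * q := by positivity
      rcases mul_eq_zero.1 g3 with h | h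
      · have hs0 : s = 0 := by rw [h] at g2; linarith
        have := LinearIndependent.pair_iff.1 i1 1 (-1) (by rw [hs, hs0]; module)
        simp at this
      · linarith
  by_cases hpq : (1 - s) * 1 ≠ s * 2
  · obtain ⟨t, ht, hm⟩ := hM1
    exact gen 2 1 t (by norm_num) (by norm_num) ht (by simpa using hm) hpq
  · obtain ⟨t, ht, hm⟩ := hM2
    refine gen 1 2 t (by norm_num) (by norm_num) ht (by simpa using hm) ?_
    push Not at hpq
    intro h
    linarith

lemma indep_of_not {x y z : E} (hyz : LinearIndependent ℝ ![y, z]) (hx : x ≠ 0)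
    (h : ¬ LinearIndependent ℝ ![x, y]) : LinearIndependent ℝ ![x, z] := by
  rw [LinearIndependent.pair_iff] at *
  push Not at h
  obtain ⟨s, t, hst, hn⟩ := h
  have hy0 : y ≠ 0 := by
    rintro rfl
    have := hyz 1 0 (by simp); simp at this
  have hs : s ≠ 0 := by
    rintro rfl
    have ht := hn rfl
    simp at hst
    tauto
  have ht : t ≠ 0 := by
    rintro rfl
    simp at hst
    tauto
  intro a b hab
  have := hyz (-(a * t)) (b * s) (by
    have : s • (a • x + b • z) - a • (s • x + t • y) = 0 := by rw [hab, hst]; simp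
    rw [← this]; module)
  obtain ⟨g1, g2⟩ := this
  simp [hs, ht] at g1 g2
  exact ⟨g1, g2⟩

lemma hom_main {M : Set E} {ψ : E → E}
    (hψ : ∀ x ∈ M, ∀ y ∈ M, LinearIndependent ℝ ![x, y] → ∃ c : ℝ, ψ x - ψ y = c • (x - y))
    {u1 u2 : E} (he : LinearIndependent ℝ ![u1, u2])
    (hM : ∀ p q : ℝ, p • u1 + q • u2 ≠ 0 → ∃ t : ℝ, 0 < t ∧ t • (p • u1 + q • u2) ∈ M)
    (h0 : (0 : E) ∉ M) : ∃ (l : ℝ) (q : E), ∀ x ∈ M, ψ x = l • x + q := by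
  have he' := LinearIndependent.pair_iff.1 he
  have hnz : ∀ p q : ℝ, (p ≠ 0 ∨ q ≠ 0) → p • u1 + q • u2 ≠ 0 := by
    intro p q hpq h
    have := he' p q h
    tauto
  obtain ⟨t1, ht1, hm1⟩ := hM 1 0 (hnz _ _ (by simp))
  obtain ⟨t2, ht2, hm2⟩ := hM 0 1 (hnz _ _ (by simp))
  obtain ⟨t3, ht3, hm3⟩ := hM (-1) (-1) (hnz _ _ (by simp))
  have ind : ∀ a b c d : ℝ, a * d - b * c ≠ 0 →
      LinearIndependent ℝ ![a • u1 + b • u2, c • u1 + d • u2] := by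
    intro a b c d h
    rw [LinearIndependent.pair_iff]
    intro s t hst
    obtain ⟨g1, g2⟩ := he' (s * a + t * c) (s * b + t * d) (by rw [← hst]; module)
    have k1 : s * (a * d - b * c) = 0 := by linear_combination d * g1 - c * g2
    have k2 : t * (a * d - b * c) = 0 := by linear_combination a * g2 - b * g1
    exact ⟨(mul_eq_zero.1 k1).resolve_right h, (mul_eq_zero.1 k2).resolve_right h⟩
  have b1e : t1 • ((1:ℝ) • u1 + (0:ℝ) • u2) = t1 • u1 + (0:ℝ) • u2 := by module
  have b2e : t2 • ((0:ℝ) • u1 + (1:ℝ) • u2) = (0:ℝ) • u1 + t2 • u2 := by module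
  have b3e : t3 • ((-1:ℝ) • u1 + (-1:ℝ) • u2) = (-t3) • u1 + (-t3) • u2 := by module
  rw [b1e] at hm1
  rw [b2e] at hm2
  rw [b3e] at hm3
  set b1 := t1 • u1 + (0:ℝ) • u2 with hb1
  set b2 := (0:ℝ) • u1 + t2 • u2 with hb2
  set b3 := (-t3) • u1 + (-t3) • u2 with hb3
  have i12 : LinearIndependent ℝ ![b1, b2] := ind _ _ _ _ (by simp; constructor <;> positivity)
  have i31 : LinearIndependent ℝ ![b3, b1] := ind _ _ _ _ (by simp; constructor <;> positivity)
  have i32 : LinearIndependent ℝ ![b3, b2] := ind _ _ _ _ (by simp; constructor <;> positivity)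
  have i13 : LinearIndependent ℝ ![b1, b3] := ind _ _ _ _ (by simp; constructor <;> positivity)
  have i23 : LinearIndependent ℝ ![b2, b3] := ind _ _ _ _ (by simp; constructor <;> positivity)
  obtain ⟨l, hl⟩ := hψ b1 hm1 b2 hm2 i12
  refine ⟨l, ψ b1 - l • b1, ?_⟩
  set χ : E → E := fun x => ψ x - (l • x + (ψ b1 - l • b1)) with hχ
  have hχp : ∀ x ∈ M, ∀ y ∈ M, LinearIndependent ℝ ![x, y] → ∃ c : ℝ, χ x - χ y = c • (x - y) := by
    intro x hx y hy hxy
    obtain ⟨c, hc⟩ := hψ x hx y hy hxy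
    refine ⟨c - l, ?_⟩
    have : χ x - χ y = (ψ x - ψ y) - l • (x - y) := by simp only [hχ]; module
    rw [this, hc]; module
  have hχ1 : χ b1 = 0 := by simp only [hχ]; module
  have hχ2 : χ b2 = 0 := by
    have : χ b2 = l • (b1 - b2) - (ψ b1 - ψ b2) := by simp only [hχ]; module
    rw [this, hl, sub_self]
  -- ray hits for hom_two
  have ray : ∀ a b c d p q : ℝ, a * d - b * c ≠ 0 → p ≠ 0 → ∃ t : ℝ, 0 < t ∧
      t • (-(p • (a • u1 + b • u2) + q • (c • u1 + d • u2))) ∈ M := by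
    intro a b c d p q h hp
    have e : -(p • (a • u1 + b • u2) + q • (c • u1 + d • u2))
      = (-(p * a + q * c)) • u1 + (-(p * b + q * d)) • u2 := by module
    rw [e]
    apply hM
    rw [← e]
    intro h'
    have := (LinearIndependent.pair_iff.1 (ind a b c d h)) p q (neg_eq_zero.1 h')
    exact hp this.1
  have ray1 : ∀ a b c d : ℝ, a * d - b * c ≠ 0 → ∃ t : ℝ, 0 < t ∧
      t • (-((2:ℝ) • (a • u1 + b • u2) + (c • u1 + d • u2))) ∈ M := by
    intro a b c d h
    have := ray a b c d 2 1 h two_ne_zero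
    simpa only [one_smul] using this
  have ray2 : ∀ a b c d : ℝ, a * d - b * c ≠ 0 → ∃ t : ℝ, 0 < t ∧
      t • (-((a • u1 + b • u2) + (2:ℝ) • (c • u1 + d • u2))) ∈ M := by
    intro a b c d h
    have := ray a b c d 1 2 h one_ne_zero
    simpa only [one_smul] using this
  have n12 : t1 * t2 - 0 * 0 ≠ 0 := by simp; constructor <;> positivity
  have n13 : t1 * (-t3) - 0 * (-t3) ≠ 0 := by simp; constructor <;> positivity
  have n23 : 0 * (-t3) - t2 * (-t3) ≠ 0 := by simp; constructor <;> positivity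
  have hχ3 : χ b3 = 0 := hom_two hχp i12 (ray1 _ _ _ _ n12) (ray2 _ _ _ _ n12) hm1 hm2 hm3
    hχ1 hχ2 i31 i32
  intro x hx
  have hx0 : x ≠ 0 := fun h => h0 (h ▸ hx)
  have : χ x = 0 := by
    by_cases j1 : LinearIndependent ℝ ![x, b1]
    · by_cases j2 : LinearIndependent ℝ ![x, b2]
      · exact hom_two hχp i12 (ray1 _ _ _ _ n12) (ray2 _ _ _ _ n12) hm1 hm2 hx hχ1 hχ2 j1 j2
      · exact hom_two hχp i13 (ray1 _ _ _ _ n13) (ray2 _ _ _ _ n13) hm1 hm3 hx hχ1 hχ3 j1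
          (indep_of_not i23 hx0 j2)
    · exact hom_two hχp i23 (ray1 _ _ _ _ n23) (ray2 _ _ _ _ n23) hm2 hm3 hx hχ2 hχ3
          (indep_of_not i12 hx0 j1) (indep_of_not i13 hx0 j1)
  exact sub_eq_zero.1 this

end Homothety

section Cone

/-- double cone of directions -/
def Dc (K : Set E) (x : E) : Set E := {z | ∃ k ∈ K, ∃ t : ℝ, z = t • (k - x)}

lemma dc_smul {K : Set E} {x z : E} (c : ℝ) (hz : z ∈ Dc K x) : c • z ∈ Dc K x := by
  obtain ⟨k, hk, t, rfl⟩ := hz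
  exact ⟨k, hk, c * t, by rw [smul_smul]⟩

lemma dc_sub {K : Set E} {x k : E} (hk : k ∈ K) : k - x ∈ Dc K x := ⟨k, hk, 1, by simp⟩

lemma dc_zero {K : Set E} {x : E} (hne : K.Nonempty) : (0 : E) ∈ Dc K x := by
  obtain ⟨k, hk⟩ := hne
  exact ⟨k, hk, 0, by simp⟩

lemma dc_g0 {K : Set E} {x g : E} (hg : ∀ k ∈ K, 0 < ⟪g, k - x⟫) {z : E} (hz : z ∈ Dc K x)
    (h : ⟪g, z⟫ = 0) : z = 0 := by
  obtain ⟨k, hk, t, rfl⟩ := hz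
  rw [real_inner_smul_right] at h
  rcases mul_eq_zero.1 h with h | h
  · simp [h]
  · have := hg k hk; linarith

lemma dc_closed {K : Set E} (hK : IsCompact K) {x g : E} (hg : ∀ k ∈ K, 0 < ⟪g, k - x⟫) :
    IsClosed (Dc K x) := by
  have : CompactSpace K := isCompact_iff_compactSpace.1 hK
  have h1 : IsClosed {p : E × K | ⟪g, (p.2 : E) - x⟫ • p.1 = ⟪g, p.1⟫ • ((p.2 : E) - x)} := by
    apply isClosed_eq <;> fun_prop
  have h2 := isClosedMap_fst_of_compactSpace (X := E) (Y := K) _ h1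
  convert h2 using 1
  ext z
  constructor
  · rintro ⟨k, hk, t, rfl⟩
    refine ⟨(t • (k - x), ⟨k, hk⟩), ?_, rfl⟩
    show ⟪g, k - x⟫ • (t • (k - x)) = ⟪g, t • (k - x)⟫ • (k - x)
    rw [real_inner_smul_right, smul_smul, mul_comm]
  · rintro ⟨⟨z', k, hk⟩, h, rfl⟩
    have h : ⟪g, k - x⟫ • z' = ⟪g, z'⟫ • (k - x) := h
    refine ⟨k, hk, ⟪g, z'⟫ / ⟪g, k - x⟫, ?_⟩
    have h0 := (hg k hk).ne'
    show z' = _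
    rw [div_eq_inv_mul, ← smul_smul, ← h, smul_smul, inv_mul_cancel₀ h0, one_smul]

lemma cross {D s : Set E} (hD : IsClosed D) (hs : IsPreconnected s) {a b : E} (ha : a ∈ s)
    (haD : a ∈ D) (hb : b ∈ s) (hbD : b ∉ D) : ∃ c ∈ s, c ∈ frontier D := by
  by_contra! hcon
  have hin : ∀ c ∈ s, c ∈ D → c ∈ interior D := by
    intro c hc hcD
    by_contra h
    exact hcon c hc ⟨subset_closure hcD, h⟩
  obtain ⟨c, hc, h1, h2⟩ := hs (interior D) Dᶜ isOpen_interior hD.isOpen_compl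
    (fun c hc => by
      by_cases h : c ∈ D
      · exact Or.inl (hin c hc h)
      · exact Or.inr h) ⟨a, ha, hin a ha haD⟩ ⟨b, hb, hbD⟩
  exact h2 (interior_subset h1)

lemma frontier_of {D : Set E} {m z : E} (hm : m ∈ D)
    (hz : ∀ᶠ t : ℝ in nhdsWithin 0 (Ioi 0), m + t • z ∉ D) : m ∈ frontier D := by
  refine ⟨subset_closure hm, fun hi => ?_⟩
  have hc : Filter.Tendsto (fun t : ℝ => m + t • z) (nhdsWithin 0 (Ioi 0)) (nhds m) := by
    have : Continuous (fun t : ℝ => m + t • z) := by fun_prop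
    have := this.tendsto 0
    simp only [zero_smul, add_zero] at this
    exact this.mono_left nhdsWithin_le_nhds
  have := hc.eventually (mem_interior_iff_mem_nhds.1 hi)
  obtain ⟨t, ht, ht0⟩ := (this.and hz).exists
  exact ht0 ht

lemma exists_g {K : Set E} (hK : IsCompact K) (hne : K.Nonempty) (hc : Convex ℝ K) {x : E}
    (hx : x ∉ K) : ∃ g : E, ∀ k ∈ K, 0 < ⟪g, k - x⟫ := by
  obtain ⟨v, -, hv⟩ := sep_line hK hne hc x 0 (by simpa using hx)
  refine ⟨-v, fun k hk => ?_⟩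
  have := supf_ge hK v hk
  rw [inner_neg_left, inner_sub_right]
  linarith

lemma nonvanish (h3 : 3 ≤ Module.finrank ℝ E) {K : Set E} (hK : IsCompact K) {x y gx gy : E}
    (hgx : ∀ k ∈ K, 0 < ⟪gx, k - x⟫) (hgy : ∀ k ∈ K, 0 < ⟪gy, k - y⟫)
    (hfr : frontier (Dc K x) = frontier (Dc K y)) {m : E} (hm : m ∈ Dc K x) (h : ⟪gy, m⟫ = 0) :
    m = 0 := by
  by_contra hm0
  obtain ⟨z, hz0, hz1, hz2⟩ := exists_orth h3 gx gy
  have hzD : z ∉ Dc K x := fun hz => hz0 (dc_g0 hgx hz hz1)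
  obtain ⟨c, hc, hcf⟩ := cross (dc_closed hK hgx) (convex_segment m z).isPreconnected
    (left_mem_segment ℝ m z) hm (right_mem_segment ℝ m z) hzD
  rw [hfr] at hcf
  have hcD : c ∈ Dc K y := (dc_closed hK hgy).frontier_subset hcf
  obtain ⟨a, b, ha, hb, hab, rfl⟩ := hc
  have h0 := dc_g0 hgy hcD (by
    rw [inner_add_right, real_inner_smul_right, real_inner_smul_right, h, hz2]; simp)
  have h1 : ⟪gx, a • m + b • z⟫ = 0 := by rw [h0]; simp
  rw [inner_add_right, real_inner_smul_right, real_inner_smul_right, hz1] at h1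
  have hgm : ⟪gx, m⟫ ≠ 0 := fun h => hm0 (dc_g0 hgx hm h)
  have ha0 : a = 0 := by
    rcases mul_eq_zero.1 (show a * ⟪gx, m⟫ = 0 by linarith) with h | h
    · exact h
    · exact absurd h hgm
  have hb1 : b = 1 := by linarith
  rw [ha0, hb1] at h0
  simp at h0
  exact hz0 h0

lemma dc_subset (h3 : 3 ≤ Module.finrank ℝ E) {K : Set E} (hK : IsCompact K) (hc : Convex ℝ K)
    {x y gx gy : E}
    (hgx : ∀ k ∈ K, 0 < ⟪gx, k - x⟫) (hgy : ∀ k ∈ K, 0 < ⟪gy, k - y⟫)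
    (hfr : frontier (Dc K x) = frontier (Dc K y)) : Dc K y ⊆ Dc K x := by
  intro m hm
  by_contra hmx
  have hne : K.Nonempty := by
    obtain ⟨k, hk, -⟩ := hm
    exact ⟨k, hk⟩
  have hm0 : m ≠ 0 := by
    rintro rfl
    exact hmx (dc_zero hne)
  have hgm : ⟪gx, m⟫ ≠ 0 := fun h => hm0 (nonvanish h3 hK hgy hgx hfr.symm hm h)
  obtain ⟨z, hz0, hz1, hz2⟩ := exists_orth h3 gx gy
  -- each half line hits Dc x
  have half : ∀ e : ℝ, e ≠ 0 → ∃ t : ℝ, 0 < t ∧ m + (e * t) • z ∈ Dc K x := by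
    intro e he
    by_contra! hcon
    -- line leaves Dc y
    have hout : ∃ t : ℝ, 0 < t ∧ m + (e * t) • z ∉ Dc K y := by
      by_contra! hin
      have hlim : Filter.Tendsto (fun s : ℝ => s • m + e • z) (nhdsWithin 0 (Ioi 0))
          (nhds (e • z)) := by
        have : Continuous (fun s : ℝ => s • m + e • z) := by fun_prop
        have := this.tendsto 0
        simp only [zero_smul, zero_add] at this
        exact this.mono_left nhdsWithin_le_nhds
      have hez : e • z ∈ Dc K y := by
        refine (dc_closed hK hgy).mem_of_tendsto hlim ?_
        filter_upwards [self_mem_nhdsWithin] with s hs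
        have hs : 0 < s := hs
        have := dc_smul s (hin s⁻¹ (inv_pos.2 hs))
        rw [smul_add, smul_smul] at this
        have e2 : s * (e * s⁻¹) = e := by field_simp
        rwa [e2] at this
      have := dc_g0 hgy hez (by rw [real_inner_smul_right, hz2, mul_zero])
      rcases smul_eq_zero.1 this with h | h
      · exact he h
      · exact hz0 h
    obtain ⟨t, ht, hto⟩ := hout
    have hpre : IsPreconnected ((fun t : ℝ => m + (e * t) • z) '' Ici 0) :=
      isPreconnected_Ici.image _ (by fun_prop)
    obtain ⟨c, ⟨s, hs, rfl⟩, hcf⟩ := cross (dc_closed hK hgy) hpre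
      (a := m) ⟨0, by simp, by simp⟩ hm ⟨t, ht.le, rfl⟩ hto
    rw [← hfr] at hcf
    have hcD := (dc_closed hK hgx).frontier_subset hcf
    rcases eq_or_lt_of_le (show (0:ℝ) ≤ s from hs) with h | h
    · subst h
      simp at hcD
      exact hmx hcD
    · exact hcon s h hcD
  obtain ⟨t1, ht1, k1, hk1, r1, h1⟩ := half 1 one_ne_zero
  obtain ⟨t2, ht2, k2, hk2, r2, h2⟩ := half (-1) (by norm_num)
  have e1 : r1 * ⟪gx, k1 - x⟫ = ⟪gx, m⟫ := by
    rw [← real_inner_smul_right, ← h1, inner_add_right, real_inner_smul_right, hz1]; simp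
  have e2 : r2 * ⟪gx, k2 - x⟫ = ⟪gx, m⟫ := by
    rw [← real_inner_smul_right, ← h2, inner_add_right, real_inner_smul_right, hz1]; simp
  have p1 := hgx k1 hk1
  have p2 := hgx k2 hk2
  -- m is a combination
  have hcomb : (t1 + t2) • m = (t2 * r1) • (k1 - x) + (t1 * r2) • (k2 - x) := by
    rw [mul_smul, mul_smul, ← h1, ← h2]; module
  have hsame : 0 < r1 * r2 := by
    have : 0 < (r1 * r2) * (⟪gx, k1 - x⟫ * ⟪gx, k2 - x⟫) := by
      have : (r1 * r2) * (⟪gx, k1 - x⟫ * ⟪gx, k2 - x⟫) = ⟪gx, m⟫ * ⟪gx, m⟫ := by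
        rw [← e1]; nth_rewrite 2 [e1]; rw [← e2]; ring
      rw [this]
      exact mul_self_pos.2 hgm
    exact (pos_iff_pos_of_mul_pos this).2 (mul_pos p1 p2)
  have hr1 : r1 ≠ 0 := by rintro rfl; simp at hsame
  have hS : t2 * r1 + t1 * r2 ≠ 0 := by
    intro h
    have : (t2 * r1 + t1 * r2) * r1 = 0 := by rw [h]; simp
    have a1 : 0 < t2 * (r1 * r1) := mul_pos ht2 (mul_self_pos.2 hr1)
    have a2 : 0 < t1 * (r1 * r2) := mul_pos ht1 hsame
    nlinarith
  have hratio1 : 0 ≤ (t2 * r1) / (t2 * r1 + t1 * r2) := by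
    rcases lt_or_gt_of_ne hr1 with h | h
    · have : r2 < 0 := by nlinarith
      apply div_nonneg_of_nonpos <;> nlinarith
    · have : 0 < r2 := by nlinarith
      positivity
  have hratio2 : 0 ≤ (t1 * r2) / (t2 * r1 + t1 * r2) := by
    rcases lt_or_gt_of_ne hr1 with h | h
    · have : r2 < 0 := by nlinarith
      apply div_nonneg_of_nonpos <;> nlinarith
    · have : 0 < r2 := by nlinarith
      positivity
  apply hmx
  refine ⟨((t2 * r1) / (t2 * r1 + t1 * r2)) • k1 + ((t1 * r2) / (t2 * r1 + t1 * r2)) • k2,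
    hc hk1 hk2 hratio1 hratio2 (by field_simp), (t2 * r1 + t1 * r2) / (t1 + t2), ?_⟩
  have ht : t1 + t2 ≠ 0 := by positivity
  apply smul_right_injective E ht
  show (t1 + t2) • m = (t1 + t2) • _
  rw [hcomb, smul_smul, mul_div_cancel₀ _ ht, smul_sub (t2 * r1 + t1 * r2), smul_add, smul_smul, smul_smul,
    mul_div_cancel₀ _ hS, mul_div_cancel₀ _ hS]
  module

lemma dc_opposite (h3 : 3 ≤ Module.finrank ℝ E) {K : Set E} (hK : IsCompact K) (hc : Convex ℝ K)
    (hi : (interior K).Nonempty) {x y : E} (hx : x ∉ K) (hy : y ∉ K) (hxy : y ≠ x)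
    (hfr : frontier (Dc K x) = frontier (Dc K y)) :
    ∀ v : E, ⟪v, x⟫ = supf K v → ⟪v, y⟫ = - supf K (-v) := by
  have hne : K.Nonempty := hi.mono interior_subset
  obtain ⟨gx, hgx⟩ := exists_g hK hne hc hx
  obtain ⟨gy, hgy⟩ := exists_g hK hne hc hy
  have s1 := dc_subset h3 hK hc hgx hgy hfr
  have s2 := dc_subset h3 hK hc hgy hgx hfr.symm
  have hnv : ∀ k ∈ K, ⟪gy, k - x⟫ ≠ 0 := by
    intro k hk h
    have := nonvanish h3 hK hgx hgy hfr (dc_sub hk) h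
    exact hx (sub_eq_zero.1 this ▸ hk)
  have htouch : ∀ v : E, ⟪v, x⟫ = supf K v → ∃ k ∈ K, ⟪v, k⟫ = ⟪v, y⟫ := by
    intro v hv
    obtain ⟨k1, hk1, h1⟩ := supf_att hK hne v
    obtain ⟨k2, hk2, t, ht⟩ := s2 (dc_sub hk1)
    refine ⟨k2, hk2, ?_⟩
    have ht0 : t ≠ 0 := by
      rintro rfl
      rw [zero_smul] at ht
      exact hx (sub_eq_zero.1 ht ▸ hk1)
    have : t * ⟪v, k2 - y⟫ = 0 := by
      rw [← real_inner_smul_right, ← ht, inner_sub_right, h1, hv, sub_self]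
    have := (mul_eq_zero.1 this).resolve_left ht0
    rw [inner_sub_right] at this
    linarith
  by_cases hpos : ∀ k ∈ K, ⟪gy, k - x⟫ < 0
  · intro v hv
    obtain ⟨k2, hk2, h2⟩ := htouch v hv
    have hge : ∀ k ∈ K, ⟪v, y⟫ ≤ ⟪v, k⟫ := by
      intro k hk
      obtain ⟨k', hk', t, ht⟩ := s1 (dc_sub hk)
      have a1 := hgy k hk
      rw [ht, real_inner_smul_right] at a1
      have a2 := hpos k' hk'
      have ht0 : t < 0 := by
        by_contra! h
        nlinarith
      have a3 : ⟪v, k' - x⟫ ≤ 0 := by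
        rw [inner_sub_right]; linarith [supf_ge hK v hk']
      have a4 : ⟪v, k - y⟫ = t * ⟪v, k' - x⟫ := by rw [ht, real_inner_smul_right]
      rw [inner_sub_right] at a4
      nlinarith
    obtain ⟨k3, hk3, h3'⟩ := supf_att hK hne (-v)
    have b1 := supf_ge hK (-v) hk2
    have b2 := hge k3 hk3
    rw [inner_neg_left] at h3' b1
    linarith
  · exfalso
    have hall : ∀ k ∈ K, 0 < ⟪gy, k - x⟫ := by
      push Not at hpos
      obtain ⟨k0, hk0, h0⟩ := hpos
      intro k hk
      by_contra! hk'
      obtain ⟨c, hcK, hc0⟩ := hc.isPreconnected.intermediate_value₂ hk hk0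
        (f := fun k => ⟪gy, k - x⟫) (g := fun _ => 0) (by fun_prop) (by fun_prop) hk' h0
      exact hnv c hcK hc0
    obtain ⟨v, -, hv, hvw⟩ := span_lemma h3 hK hc hi x 0 (y - x) (by simpa using hx)
      (by intro c; simpa using sub_ne_zero.2 hxy)
    apply hvw
    obtain ⟨k2, hk2, h2⟩ := htouch v hv
    have hle : ∀ k ∈ K, ⟪v, k⟫ ≤ ⟪v, y⟫ := by
      intro k hk
      obtain ⟨k', hk', t, ht⟩ := s1 (dc_sub hk)
      have a1 := hgy k hk
      rw [ht, real_inner_smul_right] at a1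
      have a2 := hall k' hk'
      have ht0 : 0 < t := by
        by_contra! h
        nlinarith
      have a3 : ⟪v, k' - x⟫ ≤ 0 := by
        rw [inner_sub_right]; linarith [supf_ge hK v hk']
      have a4 : ⟪v, k - y⟫ = t * ⟪v, k' - x⟫ := by rw [ht, real_inner_smul_right]
      rw [inner_sub_right] at a4
      nlinarith
    obtain ⟨k3, hk3, h3'⟩ := supf_att hK hne v
    have b1 := supf_ge hK v hk2
    have b2 := hle k3 hk3
    rw [inner_sub_right]
    linarith

/-- frontier of the double cone is scale invariant -/
lemma fr_smul {K : Set E} {x z : E} {c : ℝ} (hc : c ≠ 0) (hz : z ∈ frontier (Dc K x)) :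
    c • z ∈ frontier (Dc K x) := by
  have h := (Homeomorph.smulOfNeZero c hc : E ≃ₜ E).preimage_frontier (Dc K x)
  have h2 : (Homeomorph.smulOfNeZero c hc : E ≃ₜ E) ⁻¹' (Dc K x) = Dc K x := by
    ext w
    constructor
    · intro hw
      have hw : c • w ∈ Dc K x := hw
      have := dc_smul c⁻¹ hw
      rwa [smul_smul, inv_mul_cancel₀ hc, one_smul] at this
    · intro hw
      exact dc_smul c hw
  rw [h2] at h
  have : z ∈ (Homeomorph.smulOfNeZero c hc : E ≃ₜ E) ⁻¹' frontier (Dc K x) := by rw [h]; exact hz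
  exact this

/-- the apex is determined -/
lemma apex (h3 : 3 ≤ Module.finrank ℝ E) {K : Set E} (hK : IsCompact K) (hc : Convex ℝ K)
    (hi : (interior K).Nonempty) {x y d : E} (hy : y ∉ K)
    (hfr : ∀ z, z ∈ frontier (Dc K y) ↔ z - d ∈ frontier (Dc K x)) : d = 0 := by
  by_contra hd
  have hne : K.Nonempty := hi.mono interior_subset
  obtain ⟨g, hg⟩ := exists_g hK hne hc hy
  have hcl := dc_closed hK hg
  have tr1 : ∀ s : ℝ, s ≠ 1 → ∀ z ∈ frontier (Dc K y), z + s • d ∈ frontier (Dc K y) := by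
    intro s hs z hz
    have hs' : 1 - s ≠ 0 := sub_ne_zero.2 hs.symm
    have a1 := fr_smul (inv_ne_zero hs') hz
    have a2 := fr_smul hs' ((hfr _).1 a1)
    rw [hfr]
    convert a2 using 1
    rw [smul_sub, smul_smul, mul_inv_cancel₀ hs']
    module
  have tr : ∀ s : ℝ, ∀ z ∈ frontier (Dc K y), z + s • d ∈ frontier (Dc K y) := by
    intro s z hz
    by_cases hs : s = 1
    · have a := tr1 (1/2) (by norm_num) _ (tr1 (1/2) (by norm_num) z hz)
      convert a using 1
      rw [hs]; module
    · exact tr1 s hs z hz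
  have h0 : (0 : E) ∈ frontier (Dc K y) := by
    obtain ⟨z, hz0, hz1, -⟩ := exists_orth h3 g g
    refine frontier_of (z := z) (dc_zero hne) ?_
    filter_upwards [self_mem_nhdsWithin] with t ht hin
    have ht : 0 < t := ht
    have := dc_g0 hg hin (by simp [real_inner_smul_right, hz1])
    simp [ht.ne', hz0] at this
  have hdD : d ∈ Dc K y := by
    have := hcl.frontier_subset (tr 1 0 h0)
    simpa using this
  have hgd : ⟪g, d⟫ ≠ 0 := fun h => hd (dc_g0 hg hdD h)
  obtain ⟨v, -, hv, hvd⟩ := span_lemma h3 hK hc hi y 0 d (by simpa using hy) (by simpa using hd)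
  apply hvd
  obtain ⟨k, hk, hkv⟩ := supf_att hK hne v
  have hv0 : v ≠ 0 := by rintro rfl; simp at hvd
  have hkf : k - y ∈ frontier (Dc K y) := by
    refine frontier_of (z := v) (dc_sub hk) ?_
    have hct : Filter.Tendsto (fun t : ℝ => ⟪g, (k - y) + t • v⟫) (nhdsWithin 0 (Ioi 0))
        (nhds ⟪g, k - y⟫) := by
      have : Continuous (fun t : ℝ => ⟪g, (k - y) + t • v⟫) := by fun_prop
      have := this.tendsto 0
      simp only [zero_smul, add_zero] at this
      exact this.mono_left nhdsWithin_le_nhds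
    filter_upwards [self_mem_nhdsWithin, hct.eventually (lt_mem_nhds (hg k hk))] with t ht htg hin
    have ht : 0 < t := ht
    obtain ⟨k', hk', r, hr⟩ := hin
    rw [hr, real_inner_smul_right] at htg
    have hr0 : 0 < r := by
      by_contra! h
      have := hg k' hk'
      nlinarith
    have a1 : ⟪v, (k - y) + t • v⟫ = r * ⟪v, k' - y⟫ := by rw [hr, real_inner_smul_right]
    rw [inner_add_right, inner_sub_right, real_inner_smul_right, inner_sub_right, hkv, hv] at a1
    have a2 := supf_ge hK v hk'
    have a3 : 0 < t * ⟪v, v⟫ := mul_pos ht (real_inner_self_pos.2 hv0)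
    nlinarith
  have hin := hcl.frontier_subset (tr (-(⟪g, k - y⟫ / ⟪g, d⟫)) _ hkf)
  have hz := dc_g0 hg hin (by
    rw [inner_add_right, real_inner_smul_right, neg_mul, div_mul_cancel₀ _ hgd]; simp)
  have e : ⟪v, (k - y) + (-(⟪g, k - y⟫ / ⟪g, d⟫)) • d⟫ = 0 := by rw [hz]; simp
  rw [inner_add_right, inner_sub_right, real_inner_smul_right, hkv, hv] at e
  have hq : ⟪g, k - y⟫ / ⟪g, d⟫ ≠ 0 := div_ne_zero (hg k hk).ne' hgd
  have : (⟪g, k - y⟫ / ⟪g, d⟫) * ⟪v, d⟫ = 0 := by linarith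
  exact (mul_eq_zero.1 this).resolve_left hq

end Cone

section Main

lemma touch_unique {K : Set E} (hK : IsCompact K) (hs : StrictConvex ℝ K) {v a b : E} (hv : v ≠ 0)
    (ha : a ∈ K) (hb : b ∈ K) (hav : ⟪v, a⟫ = supf K v) (hbv : ⟪v, b⟫ = supf K v) : a = b := by
  by_contra hab
  have hm : (1/2 : ℝ) • a + (1/2 : ℝ) • b ∈ interior K :=
    hs ha hb hab (by norm_num) (by norm_num) (by norm_num)
  have hc : Filter.Tendsto (fun t : ℝ => ((1/2 : ℝ) • a + (1/2 : ℝ) • b) + t • v)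
      (nhdsWithin 0 (Ioi 0)) (nhds ((1/2 : ℝ) • a + (1/2 : ℝ) • b)) := by
    have : Continuous (fun t : ℝ => ((1/2 : ℝ) • a + (1/2 : ℝ) • b) + t • v) := by fun_prop
    have := this.tendsto 0
    simp only [zero_smul, add_zero] at this
    exact this.mono_left nhdsWithin_le_nhds
  have := hc.eventually (mem_interior_iff_mem_nhds.1 hm)
  obtain ⟨t, ht, ht0⟩ := (this.and self_mem_nhdsWithin).exists
  have ht0 : 0 < t := ht0
  have h1 := supf_ge hK v ht
  rw [inner_add_right, inner_add_right, real_inner_smul_right, real_inner_smul_right,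
    real_inner_smul_right, hav, hbv] at h1
  have h3 : 0 < t * ⟪v, v⟫ := mul_pos ht0 (real_inner_self_pos.2 hv)
  linarith

lemma plane_affine (h3 : 3 ≤ Module.finrank ℝ E) {K L U : Set E} (hK : IsCompact K)
    (hc : Convex ℝ K) (hi : (interior K).Nonempty) (hs : StrictConvex ℝ K)
    (hray : ∀ a ∈ U, ∀ e : E, e ≠ 0 → ∃ t : ℝ, 0 < t ∧ a + t • e ∈ L) (hKU : K ⊆ U)
    (hKL : ∀ x ∈ L, x ∉ K) {φ : E → E}
    (hφ : ∀ x ∈ L, ∀ v : E, ⟪v, x⟫ = supf K v → ⟪v, φ x⟫ = - supf K (-v)) {v : E} (hv : v ≠ 0) :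
    ∃ (l : ℝ) (q : E), ∀ x ∈ L, ⟪v, x⟫ = supf K v → φ x = l • x + q := by
  have hne : K.Nonempty := hi.mono interior_subset
  obtain ⟨a, ha, hav⟩ := supf_att hK hne v
  obtain ⟨u1, hu10, hu1v, -⟩ := exists_orth h3 v v
  obtain ⟨u2, hu20, hu2v, hu12⟩ := exists_orth h3 v u1
  have hu1s := real_inner_self_pos.2 hu10
  have hu2s := real_inner_self_pos.2 hu20
  have hind : LinearIndependent ℝ ![u1, u2] := by
    rw [LinearIndependent.pair_iff]
    intro s t h
    have e1 : ⟪u1, s • u1 + t • u2⟫ = 0 := by rw [h]; simp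
    have e2 : ⟪u2, s • u1 + t • u2⟫ = 0 := by rw [h]; simp
    rw [inner_add_right, real_inner_smul_right, real_inner_smul_right] at e1 e2
    rw [hu12] at e1
    rw [real_inner_comm, hu12] at e2
    constructor
    · exact (mul_eq_zero.1 (show s * ⟪u1, u1⟫ = 0 by linarith)).resolve_right hu1s.ne'
    · exact (mul_eq_zero.1 (show t * ⟪u2, u2⟫ = 0 by linarith)).resolve_right hu2s.ne'
  obtain ⟨l, q, hlq⟩ := hom_main (M := {w : E | a + w ∈ L ∧ ⟪v, w⟫ = 0})
    (ψ := fun w => φ (a + w)) (by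
      rintro w ⟨hw, hwv⟩ w' ⟨hw', hwv'⟩ hww
      by_contra! hcon
      obtain ⟨v', hv'd, hv'x, hv'w⟩ := span_lemma h3 hK hc hi (a + w) (w - w')
        (φ (a + w) - φ (a + w')) (by
          intro t ht
          have := touch_unique hK hs hv ha ht hav (by
            rw [inner_add_right, inner_add_right, real_inner_smul_right, inner_sub_right, hwv,
              hwv', hav]; simp)
          have h0 : (1 + t) • w + (-t) • w' = 0 := by
            have h1 : (a + w + t • (w - w')) - a = 0 := sub_eq_zero.2 this.symm
            rw [← h1]; module
          have := LinearIndependent.pair_iff.1 hww _ _ h0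
          linarith) hcon
      apply hv'w
      have hx' : ⟪v', a + w'⟫ = supf K v' := by
        rw [← hv'x]
        rw [inner_sub_right] at hv'd
        rw [inner_add_right, inner_add_right]
        linarith
      rw [inner_sub_right, hφ _ hw _ hv'x, hφ _ hw' _ hx', sub_self]) hind (by
      intro p r hpr
      obtain ⟨t, ht, htL⟩ := hray a (hKU ha) _ hpr
      refine ⟨t, ht, htL, ?_⟩
      rw [real_inner_smul_right, inner_add_right, real_inner_smul_right, real_inner_smul_right,
        hu1v, hu2v]
      simp) (by
      rintro ⟨h, -⟩
      rw [add_zero] at h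
      exact hKL a h ha)
  refine ⟨l, q - l • a, ?_⟩
  intro x hx hxv
  have := hlq (x - a) ⟨by simpa using hx, by rw [inner_sub_right, hav, hxv, sub_self]⟩
  simp only [add_sub_cancel] at this
  rw [this]; module

lemma local_two (h3 : 3 ≤ Module.finrank ℝ E) {K L U : Set E} (hK : IsCompact K)
    (hi : (interior K).Nonempty) (hs : StrictConvex ℝ K) (hU : IsOpen U)
    (hray : ∀ a ∈ U, ∀ e : E, e ≠ 0 → ∃ t : ℝ, 0 < t ∧ a + t • e ∈ L) (hKU : K ⊆ U)
    {u : E} (hu : ‖u‖ = 1) :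
    ∀ᶠ v in nhds u, ‖v‖ = 1 → ∃ x ∈ L, ∃ x' ∈ L, x ≠ x' ∧ ⟪u, x⟫ = supf K u ∧
      ⟪v, x⟫ = supf K v ∧ ⟪u, x'⟫ = supf K u ∧ ⟪v, x'⟫ = supf K v := by
  have hne : K.Nonempty := hi.mono interior_subset
  have hu0 : u ≠ 0 := by rintro rfl; simp at hu
  obtain ⟨a, ha, hau⟩ := supf_att hK hne u
  obtain ⟨r, hr, hball⟩ := Metric.isOpen_iff.1 hU a (hKU ha)
  -- it is enough to find a point of U in both planes
  have enough : ∀ v w : E, w ∈ U → ⟪u, w⟫ = supf K u → ⟪v, w⟫ = supf K v →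
      ∃ x ∈ L, ∃ x' ∈ L, x ≠ x' ∧ ⟪u, x⟫ = supf K u ∧
      ⟪v, x⟫ = supf K v ∧ ⟪u, x'⟫ = supf K u ∧ ⟪v, x'⟫ = supf K v := by
    intro v w hw huw hvw
    obtain ⟨d, hd0, hd1, hd2⟩ := exists_orth h3 u v
    obtain ⟨t1, ht1, hL1⟩ := hray w hw d hd0
    obtain ⟨t2, ht2, hL2⟩ := hray w hw (-d) (neg_ne_zero.2 hd0)
    refine ⟨_, hL1, _, hL2, ?_, ?_, ?_, ?_, ?_⟩
    · intro h
      have h1 : (t1 + t2) • d = (w + t1 • d) - (w + t2 • (-d)) := by module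
      rw [h, sub_self] at h1
      rcases smul_eq_zero.1 h1 with h | h
      · linarith
      · exact hd0 h
    all_goals
      simp [inner_add_right, real_inner_smul_right, hd1, hd2, huw, hvw]
  have hcont : ∀ᶠ v in nhds u, ∀ k ∈ K, ⟪v, k⟫ = supf K v → dist k a < r / 2 := by
    have hK' : IsCompact (K \ ball a (r/2)) := hK.diff isOpen_ball
    have : CompactSpace ↑(K \ ball a (r/2)) := isCompact_iff_compactSpace.1 hK'
    have h1 : IsClosed {p : E × ↑(K \ ball a (r/2)) | ⟪p.1, (p.2 : E)⟫ = supf K p.1} := by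
      apply isClosed_eq
      · fun_prop
      · exact (supf_cont hK).comp continuous_fst
    have h2 := isClosedMap_fst_of_compactSpace (X := E) (Y := ↑(K \ ball a (r/2))) _ h1
    have h4 : u ∈ (Prod.fst '' {p : E × ↑(K \ ball a (r/2)) | ⟪p.1, (p.2 : E)⟫ = supf K p.1})ᶜ := by
      rintro ⟨⟨u', k, hk⟩, hp, rfl⟩
      have hp : ⟪u', k⟫ = supf K u' := hp
      have := touch_unique hK hs hu0 ha hk.1 hau hp
      apply hk.2
      rw [← this]
      exact mem_ball_self (by positivity)
    filter_upwards [h2.isOpen_compl.mem_nhds h4] with v hv k hk hkv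
    by_contra! h
    exact hv ⟨(v, ⟨k, hk, by simpa using h⟩), hkv, rfl⟩
  filter_upwards [hcont, Metric.ball_mem_nhds u one_pos] with v hv hvu hv1
  by_cases hvu0 : v = u
  · subst hvu0
    exact enough v a (hKU ha) hau hau
  have huu : ⟪u, u⟫ = 1 := by rw [real_inner_self_eq_norm_sq, hu]; norm_num
  have hvv : ⟪v, v⟫ = 1 := by rw [real_inner_self_eq_norm_sq, hv1]; norm_num
  obtain ⟨t, ht⟩ : ∃ t, t = ⟪u, v⟫ := ⟨_, rfl⟩
  have ht' : ⟪v, u⟫ = t := by rw [ht, real_inner_comm]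
  have hdist : ‖v - u‖ ^ 2 = 2 - 2 * t := by
    rw [← real_inner_self_eq_norm_sq, inner_sub_left, inner_sub_right, inner_sub_right, huu, hvv,
      ht', ← ht]; ring
  have hvu1 : ‖v - u‖ < 1 := by rwa [mem_ball, dist_eq_norm] at hvu
  have htpos : 0 < t := by nlinarith [norm_nonneg (v - u)]
  have ht1 : t < 1 := by
    have : 0 < ‖v - u‖ := norm_pos_iff.2 (sub_ne_zero.2 hvu0)
    nlinarith
  have hden : 0 < 1 - t ^ 2 := by nlinarith
  obtain ⟨k, hk, hkv⟩ := supf_att hK hne v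
  have hka := hv k hk hkv
  rw [dist_eq_norm] at hka
  obtain ⟨η, hη⟩ : ∃ η, η = supf K v - ⟪v, a⟫ := ⟨_, rfl⟩
  have hη0 : 0 ≤ η := by rw [hη]; linarith [supf_ge hK v ha]
  have hη1 : η ≤ ‖v - u‖ * ‖k - a‖ := by
    refine le_trans ?_ (real_inner_le_norm (v - u) (k - a))
    rw [inner_sub_left, inner_sub_right, inner_sub_right, hkv, hau, hη]
    linarith [supf_ge hK u hk]
  have hη2 : η ^ 2 ≤ (2 - 2 * t) * ‖k - a‖ ^ 2 := by
    rw [← hdist, ← mul_pow]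
    exact pow_le_pow_left₀ hη0 hη1 2
  have hee : ‖v - t • u‖ ^ 2 = 1 - t ^ 2 := by
    rw [← real_inner_self_eq_norm_sq, inner_sub_left, inner_sub_right, inner_sub_right,
      real_inner_smul_left, real_inner_smul_left, real_inner_smul_right, real_inner_smul_right,
      huu, hvv, ht', ← ht]; ring
  refine enough v (a + (η / (1 - t ^ 2)) • (v - t • u)) (hball ?_) ?_ ?_
  · rw [mem_ball, dist_eq_norm, add_sub_cancel_left]
    apply lt_of_pow_lt_pow_left₀ 2 hr.le
    rw [norm_smul, mul_pow, hee, Real.norm_eq_abs, sq_abs, div_pow]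
    have e1 : η ^ 2 / (1 - t ^ 2) ^ 2 * (1 - t ^ 2) = η ^ 2 / (1 - t ^ 2) := by
      field_simp
    rw [e1, div_lt_iff₀ hden]
    have hk2 : ‖k - a‖ ^ 2 < (r / 2) ^ 2 := pow_lt_pow_left₀ hka (norm_nonneg _) two_ne_zero
    have e2 : (2 - 2 * t) * ‖k - a‖ ^ 2 < (2 - 2 * t) * (r / 2) ^ 2 :=
      mul_lt_mul_of_pos_left hk2 (by linarith)
    have e3 : (2 - 2 * t) * (r / 2) ^ 2 ≤ r ^ 2 * (1 - t ^ 2) := by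
      have : r ^ 2 * (1 - t ^ 2) - (2 - 2 * t) * (r / 2) ^ 2 = r ^ 2 * (1 - t) * (1 / 2 + t) := by
        ring
      have : 0 ≤ r ^ 2 * (1 - t) * (1 / 2 + t) :=
        mul_nonneg (mul_nonneg (sq_nonneg r) (by linarith)) (by linarith)
      linarith
    linarith
  · rw [inner_add_right, real_inner_smul_right, inner_sub_right, real_inner_smul_right, huu, hau,
      ← ht]; ring
  · rw [inner_add_right, real_inner_smul_right, inner_sub_right, real_inner_smul_right, ht', hvv]
    have : η / (1 - t ^ 2) * (1 - t * t) = η := by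
      rw [← pow_two]; field_simp
    rw [this, hη]; ring

lemma mem_of_supf {K : Set E} (hK : IsCompact K) (hne : K.Nonempty) (hc : Convex ℝ K) {z : E}
    (h : ∀ v, ⟪v, z⟫ ≤ supf K v) : z ∈ K := by
  by_contra hz
  obtain ⟨v, -, hv⟩ := sep_line hK hne hc z 0 (by simpa using hz)
  linarith [h v]

theorem main_aux (h3 : 3 ≤ Module.finrank ℝ E) {K L U : Set E} (hK : IsCompact K)
    (hc : Convex ℝ K) (hi : (interior K).Nonempty) (hs : StrictConvex ℝ K) (hU : IsOpen U)
    (hray : ∀ a ∈ U, ∀ e : E, e ≠ 0 → ∃ t : ℝ, 0 < t ∧ a + t • e ∈ L) (hKU : K ⊆ U)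
    (hKL : ∀ x ∈ L, x ∉ K)
    (hop : ∀ x ∈ L, ∃ y ∈ L, ∀ v : E, ⟪v, x⟫ = supf K v → ⟪v, y⟫ = - supf K (-v)) :
    ∃ q : E, (∀ z ∈ K, q - z ∈ K) ∧ (∀ z ∈ L, q - z ∈ L) := by
  have hne : K.Nonempty := hi.mono interior_subset
  choose! φ hφL hφ using hop
  have hu0 : ∀ u : sphere (0 : E) 1, (u : E) ≠ 0 := fun u => ne_zero_of_mem_unit_sphere u
  have hpl := fun u : sphere (0 : E) 1 => plane_affine h3 hK hc hi hs hray hKU hKL hφ (hu0 u)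
  choose l q hlq using hpl
  have : PreconnectedSpace (sphere (0 : E) 1) := by
    apply Subtype.preconnectedSpace
    apply isPreconnected_sphere
    rw [← Module.finrank_eq_rank]
    exact_mod_cast (by omega : 1 < Module.finrank ℝ E)
  have hloc : IsLocallyConstant (fun u => (l u, q u)) := by
    rw [IsLocallyConstant.iff_eventually_eq]
    intro u
    have h1 := local_two h3 hK hi hs hU hray hKU (u := (u : E)) (by simp)
    have h2 := (continuous_subtype_val.tendsto u).eventually h1
    filter_upwards [h2] with v hv
    obtain ⟨x, hx, x', hx', hxx, a1, a2, a3, a4⟩ := hv (by simp)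
    have b1 := (hlq u x hx a1).symm.trans (hlq v x hx a2)
    have b2 := (hlq u x' hx' a3).symm.trans (hlq v x' hx' a4)
    have e : (l v - l u) • (x - x') = 0 := by
      have : (l v - l u) • (x - x') = (l v • x + q v) - (l u • x + q u)
        - ((l v • x' + q v) - (l u • x' + q u)) := by module
      rw [this, b1, b2]; simp
    have e1 : l v = l u := by
      rcases smul_eq_zero.1 e with h | h
      · exact sub_eq_zero.1 h
      · exact absurd (sub_eq_zero.1 h) hxx
    have e2 : q v = q u := by
      rw [e1] at b1
      exact (add_left_cancel b1).symm
    rw [e1, e2]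
  -- a base point
  obtain ⟨z0, hz0, -, -⟩ := exists_orth h3 0 0
  have hnrm : ∀ v : E, v ≠ 0 → ‖v‖⁻¹ • v ∈ sphere (0 : E) 1 := by
    intro v hv
    rw [mem_sphere_zero_iff_norm, norm_smul, norm_inv, norm_norm, inv_mul_cancel₀]
    exact norm_ne_zero_iff.2 hv
  set u0 : sphere (0 : E) 1 := ⟨_, hnrm z0 hz0⟩
  have hsc : ∀ (v : E) (c : ℝ), 0 < c → supf K (c • v) = c * supf K v := by
    intro v c hc
    obtain ⟨k, hk, hkv⟩ := supf_att hK hne v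
    obtain ⟨k', hk', hkv'⟩ := supf_att hK hne (c • v)
    have a1 := supf_ge hK v hk'
    have a2 := supf_ge hK (c • v) hk
    rw [real_inner_smul_left] at hkv' a2
    apply le_antisymm
    · rw [← hkv']; exact mul_le_mul_of_nonneg_left a1 hc.le
    · rw [← hkv]; exact a2
  have hglob : ∀ x ∈ L, φ x = l u0 • x + q u0 := by
    intro x hx
    obtain ⟨v, -, hv, hvz⟩ := span_lemma h3 hK hc hi x 0 z0 (by simpa using hKL x hx)
      (by simpa using hz0)
    have hv0 : v ≠ 0 := by rintro rfl; simp at hvz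
    have h1 := hlq ⟨_, hnrm v hv0⟩ x hx (by
      show ⟪‖v‖⁻¹ • v, x⟫ = supf K (‖v‖⁻¹ • v)
      rw [hsc _ _ (inv_pos.2 (norm_pos_iff.2 hv0)), real_inner_smul_left, hv])
    have h2 := hloc.apply_eq_of_preconnectedSpace ⟨_, hnrm v hv0⟩ u0
    simp only [Prod.mk.injEq] at h2
    rw [h2.1, h2.2] at h1
    exact h1
  generalize l u0 = lam at hglob
  generalize q u0 = qq at hglob
  have hsupp : ∀ v : E, v ≠ 0 → - supf K (-v) = lam * supf K v + ⟪v, qq⟫ := by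
    intro v hv
    obtain ⟨a, ha, hav⟩ := supf_att hK hne v
    obtain ⟨d, hd0, hd, -⟩ := exists_orth h3 v v
    obtain ⟨t, ht, htL⟩ := hray a (hKU ha) d hd0
    have hx : ⟪v, a + t • d⟫ = supf K v := by
      rw [inner_add_right, real_inner_smul_right, hd, hav]; simp
    rw [← hφ _ htL v hx, hglob _ htL, inner_add_right, real_inner_smul_right, hx]
  have hlam : lam = -1 := by
    have a1 := hsupp z0 hz0
    have a2 := hsupp (-z0) (neg_ne_zero.2 hz0)
    rw [neg_neg, inner_neg_left] at a2
    have a3 := supf_width hK hi hz0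
    have : (lam + 1) * (supf K z0 + supf K (-z0)) = 0 := by linarith
    have := (mul_eq_zero.1 this).resolve_right a3.ne'
    linarith
  subst hlam
  refine ⟨qq, ?_, ?_⟩
  · intro z hz
    apply mem_of_supf hK hne hc
    intro v
    by_cases hv : v = 0
    · subst hv
      have := supf_ge hK 0 hz
      simpa using this
    · have a1 := hsupp v hv
      have a2 := supf_ge hK (-v) hz
      rw [inner_neg_left] at a2
      rw [inner_sub_right]
      linarith
  · intro z hz
    have := hφL z hz
    rw [hglob z hz] at this
    convert this using 1
    module

end Main

end Aux

lemma mem_solidCone {n : ℕ} {K : Set (Euc n)} {x z : Euc n} :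
    z ∈ solidCone K x ↔ z - x ∈ Dc K x := by
  simp only [solidCone, mem_iUnion, SetLike.mem_coe, exists_prop]
  constructor
  · rintro ⟨k, hk, h⟩
    obtain ⟨r, rfl⟩ := mem_affineSpan_pair_iff_exists_lineMap_eq.1 h
    exact ⟨k, hk, r, by simp [AffineMap.lineMap_apply]⟩
  · rintro ⟨k, hk, t, h⟩
    refine ⟨k, hk, mem_affineSpan_pair_iff_exists_lineMap_eq.2 ⟨t, ?_⟩⟩
    simp [AffineMap.lineMap_apply, ← h]

lemma mem_supportCone {n : ℕ} {K : Set (Euc n)} {x z : Euc n} :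
    z ∈ supportCone K x ↔ z - x ∈ frontier (Dc K x) := by
  have h := (Homeomorph.addRight (-x) : Euc n ≃ₜ Euc n).preimage_frontier (Dc K x)
  have h2 : (Homeomorph.addRight (-x) : Euc n ≃ₜ Euc n) ⁻¹' (Dc K x) = solidCone K x := by
    ext w
    rw [mem_solidCone, sub_eq_add_neg]
    rfl
  rw [h2] at h
  rw [supportCone, ← h, sub_eq_add_neg]
  rfl

/-- Main theorem. If every support double-cone of `K` with apex
on `L` is a translate of another one with apex on `L`, then `K` and `L` are
centrally symmetric with a common center. -/
theorem stmt_0 (n : ℕ) (hn : 3 ≤ n) (K L : Set (Euc n))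
    (hK : IsConvexBody K) (hKs : StrictConvex ℝ K)
    (hL : IsSphereEmbeddingImage (n - 1) L)
    (hcomp : ∃ z ∈ Lᶜ, Bornology.IsBounded (connectedComponentIn Lᶜ z) ∧
      K ⊆ connectedComponentIn Lᶜ z)
    (hcone : ∀ x ∈ L, ∃ y ∈ L, y ≠ x ∧ ∃ p : Euc n,
      supportCone K y = (fun z => p + z) '' supportCone K x) :
    ∃ c : Euc n, K = (fun z => (2 : ℝ) • c - z) '' K ∧
      L = (fun z => (2 : ℝ) • c - z) '' L := by
  obtain ⟨hKc, hc, hi⟩ := hK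
  have h3 : 3 ≤ Module.finrank ℝ (Euc n) := by simpa using hn
  obtain ⟨z, hz, hbd, hKU⟩ := hcomp
  obtain ⟨f, hf, -, hfL⟩ := hL
  have hLc : IsClosed L := by
    rw [← hfL]
    exact (isCompact_range hf).isClosed
  have hsub : connectedComponentIn Lᶜ z ⊆ Lᶜ := connectedComponentIn_subset _ _
  have hKL : ∀ x ∈ L, x ∉ K := fun x hx hxK => hsub (hKU hxK) hx
  have hray : ∀ a ∈ connectedComponentIn Lᶜ z, ∀ e : Euc n, e ≠ 0 →
      ∃ t : ℝ, 0 < t ∧ a + t • e ∈ L := by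
    intro a ha e he
    by_contra! hcon
    have hpre : IsPreconnected ((fun t : ℝ => a + t • e) '' Ici 0) :=
      isPreconnected_Ici.image _ (by fun_prop)
    have hs := hpre.subset_connectedComponentIn (F := Lᶜ) (x := a) ⟨0, by simp, by simp⟩ (by
      rintro _ ⟨t, ht, rfl⟩
      rcases eq_or_lt_of_le (show (0:ℝ) ≤ t from ht) with h | h
      · subst h
        simpa using hsub ha
      · exact hcon t h)
    rw [← connectedComponentIn_eq ha] at hs
    obtain ⟨R, hR⟩ := (hbd.subset hs).exists_norm_le
    have hR0 := hR (a + (0:ℝ) • e) ⟨0, by simp, rfl⟩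
    have hen : 0 < ‖e‖ := norm_pos_iff.2 he
    have hRn : 0 ≤ R := le_trans (norm_nonneg _) hR0
    have ht0 : 0 ≤ (2 * R + 1) / ‖e‖ := by positivity
    have hR1 := hR (a + ((2 * R + 1) / ‖e‖) • e) ⟨_, ht0, rfl⟩
    have h5 : ‖((2 * R + 1) / ‖e‖) • e‖ = 2 * R + 1 := by
      rw [norm_smul, Real.norm_of_nonneg ht0, div_mul_cancel₀ _ hen.ne']
    have h6 : ((2 * R + 1) / ‖e‖) • e = (a + ((2 * R + 1) / ‖e‖) • e) - (a + (0:ℝ) • e) := by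
      module
    have h7 := norm_sub_le (a + ((2 * R + 1) / ‖e‖) • e) (a + (0:ℝ) • e)
    rw [← h6, h5] at h7
    linarith
  obtain ⟨q, hq1, hq2⟩ := main_aux h3 hKc hc hi hKs (hLc.isOpen_compl.connectedComponentIn)
    hray hKU hKL (by
      intro x hx
      obtain ⟨y, hy, hyx, p, hp⟩ := hcone x hx
      have hfr : ∀ w, w ∈ frontier (Dc K y) ↔ w - (p + x - y) ∈ frontier (Dc K x) := by
        intro w
        have e1 : w ∈ frontier (Dc K y) ↔ w + y ∈ supportCone K y := by
          rw [mem_supportCone, add_sub_cancel_right]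
        have e2 : w - (p + x - y) ∈ frontier (Dc K x) ↔ w + y - p ∈ supportCone K x := by
          rw [mem_supportCone]
          have : w - (p + x - y) = w + y - p - x := by abel
          rw [this]
        rw [e1, e2, hp]
        constructor
        · rintro ⟨s, hs, h⟩
          have : w + y - p = s := by rw [← h]; simp
          rwa [this]
        · intro h
          exact ⟨_, h, by simp⟩
      have hd := apex h3 hKc hc hi (hKL y hy) hfr
      rw [hd] at hfr
      refine ⟨y, hy, dc_opposite h3 hKc hc hi (hKL x hx) (hKL y hy) hyx ?_⟩
      ext w
      rw [hfr, sub_zero])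
  have hsymm : ∀ S : Set (Euc n), (∀ z ∈ S, q - z ∈ S) →
      S = (fun z => (2 : ℝ) • ((1 / 2 : ℝ) • q) - z) '' S := by
    intro S hS
    have e : (2 : ℝ) • ((1 / 2 : ℝ) • q) = q := by rw [smul_smul]; norm_num
    rw [e]
    ext w
    constructor
    · intro hw
      exact ⟨q - w, hS w hw, by simp⟩
    · rintro ⟨s, hs, rfl⟩
      exact hS s hs
  exact ⟨(1 / 2 : ℝ) • q, hsymm K hq1, hsymm L hq2⟩
end
end

section
/- Assume the Setting. Let x, y ∈ L with y ≠ x and C_y = p + C_x for some p ∈ ℝ^n. Let Π_1, Π_2 be two distinct support hyperplanes of K with x ∈ Π_1 ∩ Π_2, and let Γ_1, Γ_2 be support hyperplanes of K with Γ_i parallel to Π_i and Γ_i ≠ Π_i for i = 1, 2. Suppose there exists a point x̄ ∈ Π_1 ∩ Π_2 ∩ L with x̄ ≠ x (i.e., Π_1 ∩ Π_2 is not a supporting (n−2)-dimensional plane of L). Let k_i be the unique contact point of Π_i with bd K and let l_i be the unique contact point of Γ_i with bd K, for i = 1, 2. Then the segments [k_1, k_2] and [l_1, l_2] are parallel; that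 is, l_2 − l_1 is a scalar multiple of k_2 − k_1. -/
open Set Metric RealInnerProductSpace

noncomputable section

/-- Linear double cone. -/
def dcone {n : ℕ} (K : Set (Euc n)) (x : Euc n) : Set (Euc n) :=
  {w | ∃ z ∈ K, ∃ c : ℝ, w = c • (z - x)}

/-- Translate of a set. -/
def trl {n : ℕ} (D : Set (Euc n)) (a : Euc n) : Set (Euc n) := {z | z - a ∈ D}

lemma solidCone_eq {n : ℕ} (K : Set (Euc n)) (x : Euc n) :
    solidCone K x = trl (dcone K x) x := by
  ext z
  simp only [solidCone, trl, dcone, mem_iUnion, SetLike.mem_coe,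
    mem_affineSpan_pair_iff_exists_lineMap_eq, mem_ofPred_eq, exists_prop, AffineMap.lineMap_apply,
    vsub_eq_sub, vadd_eq_add]
  constructor
  · rintro ⟨a, ha, r, rfl⟩
    exact ⟨a, ha, r, by simp⟩
  · rintro ⟨a, ha, r, h⟩
    exact ⟨a, ha, r, by rw [← h]; simp⟩

lemma dcone_smul {n : ℕ} {K : Set (Euc n)} {x w : Euc n} (c : ℝ) (h : w ∈ dcone K x) :
    c • w ∈ dcone K x := by
  obtain ⟨z, hz, d, rfl⟩ := h
  exact ⟨z, hz, c * d, by rw [smul_smul]⟩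

lemma dcone_add {n : ℕ} {K : Set (Euc n)} (hK : Convex ℝ K) {x z z' : Euc n} {c t : ℝ}
    (hz : z ∈ K) (hz' : z' ∈ K) (hc : 0 ≤ c) (ht : 0 ≤ t) :
    c • (z - x) + t • (z' - x) ∈ dcone K x := by
  rcases eq_or_lt_of_le (add_nonneg hc ht) with h | h
  · have h1 : c = 0 := by linarith
    have h2 : t = 0 := by linarith
    exact ⟨z, hz, 0, by simp [h1, h2]⟩
  · refine ⟨(c / (c + t)) • z + (t / (c + t)) • z', hK hz hz' (by positivity) (by positivity)
      (by field_simp), c + t, ?_⟩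
    have h1 : (c + t) * (c / (c + t)) = c := by field_simp
    have h2 : (c + t) * (t / (c + t)) = t := by field_simp
    rw [smul_sub (c + t), smul_add (c + t), smul_smul, smul_smul, h1, h2]
    module

lemma dcone_closed {n : ℕ} {K : Set (Euc n)} (hK : IsCompact K) {x : Euc n}
    (f : Euc n →L[ℝ] ℝ) (hf : ∀ z ∈ K, 0 < f (z - x)) : IsClosed (dcone K x) := by
  have : CompactSpace K := isCompact_iff_compactSpace.mp hK
  have hc : IsClosed {q : Euc n × K | f (q.2.1 - x) • q.1 = f q.1 • (q.2.1 - x)} :=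
    isClosed_eq (by fun_prop) (by fun_prop)
  have := isClosedMap_fst_of_compactSpace _ hc
  convert this using 1
  ext w
  simp only [dcone, mem_ofPred_eq, mem_image, Prod.exists, Subtype.exists, exists_and_right,
    exists_eq_right]
  constructor
  · rintro ⟨z, hz, c, rfl⟩
    refine ⟨z, hz, ?_⟩
    simp only [map_smul, smul_smul, smul_eq_mul]
    rw [mul_comm]
  · rintro ⟨z, hz, h⟩
    refine ⟨z, hz, f w / f (z - x), ?_⟩
    have := (hf z hz).ne'
    rw [div_eq_inv_mul, ← smul_smul, ← h, smul_smul, inv_mul_cancel₀ this, one_smul]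

lemma ker_preconn {n : ℕ} (hn : 3 ≤ n) (f : Euc n →L[ℝ] ℝ) :
    IsPreconnected {h : Euc n | f h = 0 ∧ h ≠ 0} := by
  let V := LinearMap.ker (f : Euc n →ₗ[ℝ] ℝ)
  have h1 := LinearMap.finrank_range_add_finrank_ker (f : Euc n →ₗ[ℝ] ℝ)
  have h2 : Module.finrank ℝ (LinearMap.range (f : Euc n →ₗ[ℝ] ℝ)) ≤ 1 := by
    simpa using Submodule.finrank_le (LinearMap.range (f : Euc n →ₗ[ℝ] ℝ))
  rw [finrank_euclideanSpace_fin] at h1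
  have h3 : 1 < Module.finrank ℝ V := by
    change 1 < Module.finrank ℝ (LinearMap.ker (f : Euc n →ₗ[ℝ] ℝ))
    omega
  have h4 : 1 < Module.rank ℝ V := by
    rw [← Module.finrank_eq_rank]; exact_mod_cast h3
  have h5 := (isConnected_compl_singleton_of_one_lt_rank h4 0).isPreconnected.image
    (Subtype.val : V → Euc n) continuous_subtype_val.continuousOn
  convert h5 using 1
  ext h
  constructor
  · rintro ⟨h1, h2⟩
    exact ⟨⟨h, h1⟩, fun h3 => h2 (congrArg Subtype.val h3), rfl⟩
  · rintro ⟨⟨a, ha⟩, hb, rfl⟩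
    exact ⟨ha, by simpa using hb⟩

lemma dcone_compl_preconn {n : ℕ} (hn : 3 ≤ n) {K : Set (Euc n)} (hK : Convex ℝ K)
    (hne : K.Nonempty) {x : Euc n}
    (f : Euc n →L[ℝ] ℝ) (hf : ∀ z ∈ K, 0 < f (z - x)) {w : Euc n} (hw : f w = 0) (hw0 : w ≠ 0) :
    IsPreconnected (dcone K x)ᶜ := by
  obtain ⟨z0, hz0⟩ := hne
  have key : ∀ e, 0 ≤ f e → ∀ t, 0 ≤ t → t ≤ f e / f (z0 - x) → e ∉ dcone K x →
      e - t • (z0 - x) ∉ dcone K x := by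
    rintro e he t ht hte h ⟨z, hz, c, hzc⟩
    have h1 : f e - t * f (z0 - x) = c * f (z - x) := by
      have := congrArg f hzc
      simpa only [map_sub, map_smul, smul_eq_mul] using this
    rw [le_div_iff₀ (hf z0 hz0)] at hte
    have hc : 0 ≤ c := by
      by_contra hc
      have := mul_neg_of_neg_of_pos (not_le.mp hc) (hf z hz)
      linarith
    apply h
    have : e = c • (z - x) + t • (z0 - x) := by rw [← hzc]; abel
    rw [this]
    exact dcone_add hK hz hz0 hc ht
  have hV : {h : Euc n | f h = 0 ∧ h ≠ 0} ⊆ (dcone K x)ᶜ := by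
    rintro h ⟨h1, h2⟩ ⟨z, hz, c, rfl⟩
    have := (hf z hz).ne'
    simp only [map_smul, smul_eq_mul, mul_eq_zero, this, or_false] at h1
    simp [h1] at h2
  have hneg : ∀ e, -e ∈ dcone K x → e ∈ dcone K x := by
    intro e he
    simpa using dcone_smul (-1) he
  have hfz := hf z0 hz0
  have key2 : ∀ e, e ∉ dcone K x → ∀ t ∈ segment ℝ 0 (f e / f (z0 - x)),
      e - t • (z0 - x) ∉ dcone K x := by
    intro e he t ht
    rcases le_total 0 (f e) with h | h
    · rw [segment_eq_Icc (by positivity)] at ht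
      exact key e h t ht.1 ht.2 he
    · rw [segment_symm, segment_eq_Icc (div_nonpos_of_nonpos_of_nonneg h hfz.le)] at ht
      have := key (-e) (by simpa using h) (-t) (by linarith [ht.2])
        (by rw [map_neg, neg_div]; linarith [ht.1]) (fun h' => he (hneg _ h'))
      intro h'
      apply this
      apply hneg
      convert h' using 1
      module
  apply isPreconnected_of_forall w
  intro e he
  refine ⟨(fun t : ℝ => e - t • (z0 - x)) '' segment ℝ 0 (f e / f (z0 - x)) ∪
    {h : Euc n | f h = 0 ∧ h ≠ 0}, ?_, Or.inr ⟨hw, hw0⟩,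
    Or.inl ⟨0, left_mem_segment _ _ _, by simp⟩, ?_⟩
  · apply union_subset _ hV
    rintro _ ⟨t, ht, rfl⟩
    exact key2 e he t ht
  · refine IsPreconnected.union (e - (f e / f (z0 - x)) • (z0 - x))
      ⟨_, right_mem_segment _ _ _, rfl⟩ ⟨?_, ?_⟩ ?_ (ker_preconn hn f)
    · rw [map_sub, map_smul, smul_eq_mul, div_mul_cancel₀ _ hfz.ne', sub_self]
    · intro h0
      refine key2 e he _ (right_mem_segment _ _ _) ?_
      rw [h0]
      exact ⟨z0, hz0, 0, by simp⟩
    · exact ((convex_segment _ _).isPreconnected).image _ (by fun_prop)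

lemma trl_sub {n : ℕ} {D D' : Set (Euc n)} (hc : IsClosed D)
    (hp : IsPreconnected Dᶜ) {a b z : Euc n}
    (hz : z ∉ trl D a) (hz' : z ∉ trl D' b) (hfr : frontier (trl D a) = frontier (trl D' b)) :
    trl D' b ⊆ trl D a := by
  intro q hq
  by_contra hqa
  have h1 : IsPreconnected (trl D a)ᶜ := by
    have := hp.image (fun w => w + a) (by fun_prop)
    convert this using 1
    ext w
    simp only [trl, mem_compl_iff, mem_ofPred_eq, mem_image]
    constructor
    · intro h; exact ⟨_, h, by simp⟩
    · rintro ⟨v, hv, rfl⟩; simpa using hv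
  have h2 : IsClosed (trl D a) := hc.preimage (f := fun w => w - a) (by fun_prop)
  obtain ⟨r, hr, hr'⟩ : ((trl D a)ᶜ ∩ frontier (trl D' b)).Nonempty := by
    by_contra hcon
    have hdis : ∀ v ∈ (trl D a)ᶜ, v ∉ frontier (trl D' b) := fun v hv hv' => hcon ⟨v, hv, hv'⟩
    have hin : ∀ v ∈ (trl D a)ᶜ, v ∈ trl D' b → v ∈ interior (trl D' b) := by
      intro v hv h
      by_contra h'
      exact hdis v hv ⟨subset_closure h, h'⟩
    have hout : ∀ v ∈ (trl D a)ᶜ, v ∉ trl D' b → v ∈ (closure (trl D' b))ᶜ := by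
      intro v hv h h'
      exact hdis v hv ⟨h', fun h'' => h (interior_subset h'')⟩
    obtain ⟨v, -, hv1, hv2⟩ := h1 (interior (trl D' b)) (closure (trl D' b))ᶜ isOpen_interior
      isClosed_closure.isOpen_compl
      (fun v hv => (em (v ∈ trl D' b)).imp (hin v hv) (hout v hv))
      ⟨q, hqa, hin q hqa hq⟩ ⟨z, hz, hout z hz hz'⟩
    exact hv2 (subset_closure (interior_subset hv1))
  rw [← hfr] at hr'
  exact hr (h2.frontier_subset hr')

lemma exists_sep {n : ℕ} {K : Set (Euc n)} (hK : IsConvexBody K) {x : Euc n} (hx : x ∉ K) :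
    ∃ f : Euc n →L[ℝ] ℝ, ∀ z ∈ K, 0 < f (z - x) := by
  obtain ⟨f, s, h1, h2⟩ := geometric_hahn_banach_point_closed hK.2.1 hK.1.isClosed hx
  refine ⟨f, fun z hz => ?_⟩
  rw [map_sub]
  linarith [h2 z hz]

/-- The translated cones coincide. -/
lemma cones_eq {n : ℕ} (hn : 3 ≤ n) {K : Set (Euc n)} (hK : IsConvexBody K) {x y p : Euc n}
    (hx : x ∉ K) (hy : y ∉ K)
    (hp : supportCone K y = (fun z => p + z) '' supportCone K x) :
    trl (dcone K y) y = trl (dcone K x) (x + p) := by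
  obtain ⟨f, hf⟩ := exists_sep hK hx
  obtain ⟨g, hg⟩ := exists_sep hK hy
  have hne : K.Nonempty := hK.2.2.mono interior_subset
  have hfr : frontier (trl (dcone K y) y) = frontier (trl (dcone K x) (x + p)) := by
    rw [supportCone, supportCone, solidCone_eq, solidCone_eq] at hp
    rw [hp]
    have := (Homeomorph.addLeft p).image_frontier (trl (dcone K x) x)
    refine Eq.trans this ?_
    congr 1
    ext w
    simp only [trl, mem_image, mem_ofPred_eq, Homeomorph.coe_addLeft]
    constructor
    · rintro ⟨v, hv, rfl⟩
      convert hv using 1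
      abel
    · intro h
      exact ⟨w - p, by convert h using 1; abel, by abel⟩
  obtain ⟨w, hw, hw0⟩ : ∃ w : Euc n, w ∈ LinearMap.ker
      ((f : Euc n →ₗ[ℝ] ℝ).prod (g : Euc n →ₗ[ℝ] ℝ)) ∧ w ≠ 0 := by
    apply Submodule.exists_mem_ne_zero_of_ne_bot
    apply LinearMap.ker_ne_bot_of_finrank_lt
    rw [finrank_euclideanSpace_fin, Module.finrank_prod, Module.finrank_self]
    omega
  have hwf : f w = 0 := by simpa using congrArg Prod.fst hw
  have hwg : g w = 0 := by simpa using congrArg Prod.snd hw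
  have hnot : ∀ (x : Euc n) (f : Euc n →L[ℝ] ℝ), (∀ z ∈ K, 0 < f (z - x)) → f w = 0 →
      w ∉ dcone K x := by
    rintro x f hf hw ⟨z, hz, c, rfl⟩
    have := (hf z hz).ne'
    simp only [map_smul, smul_eq_mul, mul_eq_zero, this, or_false] at hw
    simp [hw] at hw0
  have hcx := dcone_closed hK.1 f hf
  have hcy := dcone_closed hK.1 g hg
  obtain ⟨e, he0, he⟩ : ∃ e : ℝ, 0 < e ∧ w + e • (y - (x + p)) ∈ (dcone K x)ᶜ := by
    have hcont : Filter.Tendsto (fun e : ℝ => w + e • (y - (x + p))) (nhdsWithin 0 (Ioi 0))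
        (nhds w) := by
      have : Continuous (fun e : ℝ => w + e • (y - (x + p))) := by fun_prop
      have := this.tendsto 0
      simp only [zero_smul, add_zero] at this
      exact this.mono_left nhdsWithin_le_nhds
    have h1 := hcont.eventually (hcx.isOpen_compl.mem_nhds (hnot x f hf hwf))
    have h0 : ∀ᶠ e : ℝ in nhdsWithin 0 (Ioi 0), 0 < e := self_mem_nhdsWithin
    obtain ⟨e, h2, h3⟩ := (h1.and h0).exists
    exact ⟨e, h3, h2⟩
  have hz1 : y + e⁻¹ • w ∉ trl (dcone K y) y := by
    intro h
    simp only [trl, mem_ofPred_eq, add_sub_cancel_left] at h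
    have := dcone_smul e h
    rw [smul_smul, mul_inv_cancel₀ he0.ne', one_smul] at this
    exact hnot y g hg hwg this
  have hz2 : y + e⁻¹ • w ∉ trl (dcone K x) (x + p) := by
    intro h
    have := dcone_smul e h
    apply he
    convert this using 1
    have h1 : e • e⁻¹ • w = w := by rw [smul_smul, mul_inv_cancel₀ he0.ne', one_smul]
    rw [smul_sub e (y + _), smul_add e y, h1]
    module
  apply Subset.antisymm
  · exact trl_sub hcx (dcone_compl_preconn hn hK.2.1 hne f hf hwf hw0) hz2 hz1 hfr.symm
  · exact trl_sub hcy (dcone_compl_preconn hn hK.2.1 hne g hg hwg hw0) hz1 hz2 hfr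

lemma dcone_eq {n : ℕ} (hn : 3 ≤ n) {K : Set (Euc n)} (hK : IsConvexBody K) {x y p : Euc n}
    (hx : x ∉ K) (hy : y ∉ K)
    (hp : supportCone K y = (fun z => p + z) '' supportCone K x)
    {u k l : Euc n} (hk : k ∈ K) (hl : l ∈ K) (hku : ⟪u, k - x⟫ = 0) (hlu : ⟪u, l - x⟫ ≠ 0) :
    dcone K y = dcone K x := by
  have H := cones_eq hn hK hx hy hp
  obtain ⟨f, hf⟩ := exists_sep hK hx
  set q := x + p - y with hq
  have H1 : ∀ z, z + q ∈ dcone K y ↔ z ∈ dcone K x := by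
    intro z
    have := Set.ext_iff.mp H (z + x + p)
    simp only [trl, mem_ofPred_eq] at this
    convert this using 2
    · rw [hq]; abel
    · abel
  suffices hq0 : q = 0 by
    ext z
    simpa [hq0] using H1 z
  by_contra hq0
  have H2 : ∀ z ∈ dcone K x, z + (2⁻¹ : ℝ) • q ∈ dcone K x := by
    intro z hz
    have h1 := dcone_smul 2 ((H1 z).mpr hz)
    have h2 : (2 : ℝ) • (z + q) = ((2 : ℝ) • z + q) + q := by module
    rw [h2, H1] at h1
    have h3 := dcone_smul 2⁻¹ h1
    convert h3 using 1
    module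
  have H3 : ∀ z ∈ dcone K x, ∀ c : ℝ, z + c • q ∈ dcone K x := by
    intro z hz c
    rcases eq_or_ne c 0 with rfl | hc
    · simpa using hz
    · have := dcone_smul (2 * c) (H2 _ (dcone_smul (2 * c)⁻¹ hz))
      convert this using 1
      rw [smul_add, smul_smul, smul_smul, mul_inv_cancel₀ (by simpa using hc), one_smul]
      congr 2
      ring
  have H4 : ∀ z ∈ dcone K x, f z = 0 → z = 0 := by
    rintro _ ⟨z, hz, c, rfl⟩ h
    have := (hf z hz).ne'
    simp only [map_smul, smul_eq_mul, mul_eq_zero, this, or_false] at h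
    simp [h]
  have hqD : q ∈ dcone K x := by
    have := H3 0 ⟨k, hk, 0, by simp⟩ 1
    simpa using this
  have hfq : f q ≠ 0 := fun h => hq0 (H4 q hqD h)
  have H5 : ∀ z ∈ dcone K x, ∃ c : ℝ, z = c • q := by
    intro z hz
    refine ⟨f z / f q, ?_⟩
    have := H4 _ (H3 z hz (-(f z / f q))) (by
      rw [map_add, map_smul, smul_eq_mul]; field_simp; ring)
    rw [neg_smul, ← sub_eq_add_neg, sub_eq_zero] at this
    exact this
  obtain ⟨a, ha⟩ := H5 (k - x) ⟨k, hk, 1, by simp⟩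
  obtain ⟨b, hb⟩ := H5 (l - x) ⟨l, hl, 1, by simp⟩
  rw [hb, inner_smul_right] at hlu
  rw [ha, inner_smul_right] at hku
  have : a = 0 := by
    rcases mul_eq_zero.mp hku with h | h
    · exact h
    · simp [h] at hlu
  rw [this, zero_smul, sub_eq_zero] at ha
  exact hx (ha ▸ hk)

lemma key_lemma {n : ℕ} (hn : 3 ≤ n) {K : Set (Euc n)} (hK : IsConvexBody K) {x y p : Euc n}
    (hx : x ∉ K) (hy : y ∉ K) (hxy : y ≠ x)
    (hp : supportCone K y = (fun z => p + z) '' supportCone K x)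
    {u k l : Euc n} {s t : ℝ} (hPi : K ⊆ {z | ⟪u, z⟫ ≤ s})
    (hGa : K ⊆ {z | ⟪u, z⟫ ≤ t} ∨ K ⊆ {z | t ≤ ⟪u, z⟫}) (hts : t ≠ s) (hxs : ⟪u, x⟫ = s)
    (hk : {z | ⟪u, z⟫ = s} ∩ K = {k}) (hl : {z | ⟪u, z⟫ = t} ∩ K = {l}) :
    ⟪u, y⟫ = t ∧ ∃ c : ℝ, l = y + c • (k - x) := by
  have hkm : k ∈ {z | ⟪u, z⟫ = s} ∩ K := by rw [hk]; rfl
  have hlm : l ∈ {z | ⟪u, z⟫ = t} ∩ K := by rw [hl]; rfl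
  obtain ⟨hks, hkK⟩ := hkm
  obtain ⟨hlt, hlK⟩ := hlm
  simp only [mem_ofPred_eq] at hks hlt
  have hts' : t < s := lt_of_le_of_ne (hlt ▸ hPi hlK) hts
  have hGa' : ∀ z ∈ K, t ≤ ⟪u, z⟫ := by
    rcases hGa with h | h
    · have := h hkK
      simp only [mem_ofPred_eq] at this
      linarith
    · exact fun z hz => h hz
  have hPi' : ∀ z ∈ K, ⟪u, z⟫ ≤ s := fun z hz => hPi hz
  have hD := dcone_eq hn hK hx hy hp hkK hlK (u := u) (by rw [inner_sub_right]; linarith)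
    (by rw [inner_sub_right]; linarith)
  obtain ⟨f, hf⟩ := exists_sep hK hx
  have hyx : ∀ z ∈ K, ∃ z' ∈ K, ∃ c : ℝ, z - y = c • (z' - x) := by
    intro z hz
    have : z - y ∈ dcone K y := ⟨z, hz, 1, by simp⟩
    rw [hD] at this
    exact this
  have hxy' : ∀ z ∈ K, ∃ z' ∈ K, ∃ c : ℝ, z - x = c • (z' - y) := by
    intro z hz
    have : z - x ∈ dcone K x := ⟨z, hz, 1, by simp⟩
    rw [← hD] at this
    exact this
  have hfne : ∀ z ∈ K, f (z - y) ≠ 0 := by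
    intro z hz h0
    obtain ⟨z', hz', c, hc⟩ := hyx z hz
    rw [hc, map_smul, smul_eq_mul, mul_eq_zero] at h0
    rcases h0 with h0 | h0
    · rw [h0, zero_smul, sub_eq_zero] at hc
      exact hy (hc ▸ hz)
    · exact (hf z' hz').ne' h0
  have hsign : (∀ z ∈ K, 0 < f (z - y)) ∨ (∀ z ∈ K, f (z - y) < 0) := by
    by_contra hcon
    push Not at hcon
    obtain ⟨⟨a, ha, ha'⟩, b, hb, hb'⟩ := hcon
    obtain ⟨c, hc, hc'⟩ := hK.2.1.isPreconnected.intermediate_value ha hb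
      (f := fun z => f (z - y)) (by fun_prop) ⟨ha', hb'⟩
    exact hfne c hc hc'
  rcases hsign with hpos | hneg
  · exfalso
    have hyx1 : ∀ z ∈ K, ∃ z' ∈ K, ∃ c : ℝ, 0 < c ∧ z - y = c • (z' - x) := by
      intro z hz
      obtain ⟨z', hz', c, hc⟩ := hyx z hz
      refine ⟨z', hz', c, ?_, hc⟩
      have h := hpos z hz
      rw [hc, map_smul, smul_eq_mul] at h
      exact pos_of_mul_pos_left h (hf z' hz').le
    have hxy1 : ∀ z ∈ K, ∃ z' ∈ K, ∃ c : ℝ, 0 < c ∧ z - x = c • (z' - y) := by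
      intro z hz
      obtain ⟨z', hz', c, hc⟩ := hxy' z hz
      refine ⟨z', hz', c, ?_, hc⟩
      have h := hf z hz
      rw [hc, map_smul, smul_eq_mul] at h
      exact pos_of_mul_pos_left h (hpos z' hz').le
    -- any functional supporting the cone at a point of K agrees on x and y
    have hsup : ∀ φ : Euc n →L[ℝ] ℝ, (∀ z ∈ K, φ z ≤ φ x) → ∀ z0 ∈ K, φ z0 = φ x →
        φ y = φ x ∧ ∃ z1 ∈ K, φ z1 = φ x ∧ ∃ c : ℝ, z0 - x = c • (z1 - y) := by
      intro φ hφ z0 hz0 h0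
      have h1 : ∀ z ∈ K, φ z ≤ φ y := by
        intro z hz
        obtain ⟨z', hz', c, hc, h⟩ := hyx1 z hz
        have h2 := congrArg φ h
        simp only [map_sub, map_smul, smul_eq_mul] at h2
        have h3 := mul_nonneg hc.le (sub_nonneg.mpr (hφ z' hz'))
        linarith
      obtain ⟨z1, hz1, c, hc, h⟩ := hxy1 z0 hz0
      have h2 := congrArg φ h
      simp only [map_sub, map_smul, smul_eq_mul] at h2
      rw [h0, sub_self, eq_comm, mul_eq_zero] at h2
      have h3 : φ z1 = φ y := by
        rcases h2 with h2 | h2 <;> linarith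
      have h4 : φ y = φ x := le_antisymm (h3 ▸ hφ z1 hz1) (h0 ▸ h1 z0 hz0)
      exact ⟨h4, z1, hz1, h3.trans h4, c, h⟩
    obtain ⟨hy1, z1, hz1, hz1x, μ, hμ⟩ := hsup (innerSL ℝ u)
      (fun z hz => by simpa [hxs] using hPi' z hz) k hkK (by simp [hks, hxs])
    have hz1k : z1 = k := by
      have : z1 ∈ ({k} : Set (Euc n)) := by
        rw [← hk]; exact ⟨by simpa [hxs] using hz1x, hz1⟩
      exact this
    subst hz1k
    -- maximise -u/f
    obtain ⟨z0, hz0, hmax⟩ := hK.1.exists_isMaxOn ⟨l, hlK⟩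
      (f := fun z => (s - ⟪u, z⟫) / f (z - x))
      (ContinuousOn.div (by fun_prop) (by fun_prop) (fun z hz => (hf z hz).ne'))
    set m := (s - ⟪u, z0⟫) / f (z0 - x) with hm
    have hmax' : ∀ z ∈ K, s - ⟪u, z⟫ ≤ m * f (z - x) := by
      intro z hz
      have : (s - ⟪u, z⟫) / f (z - x) ≤ m := hmax hz
      rwa [div_le_iff₀ (hf z hz)] at this
    have hm0 : 0 < m := by
      have h1 := hmax' l hlK
      have h2 := hf l hlK
      by_contra hm0
      have := mul_nonpos_of_nonpos_of_nonneg (not_lt.mp hm0) h2.le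
      linarith
    have hmz : m * f (z0 - x) = s - ⟪u, z0⟫ := div_mul_cancel₀ _ (hf z0 hz0).ne'
    obtain ⟨hy2, -⟩ := hsup (-(innerSL ℝ u) - m • f)
      (fun z hz => by
        have := hmax' z hz
        simp only [map_sub] at this
        simp [hxs]
        linarith) z0 hz0 (by
        simp only [map_sub] at hmz
        simp [hxs]
        linarith)
    simp at hy1 hy2
    have hfy : f y = f x := by
      have : m * (f y - f x) = 0 := by linarith
      rcases mul_eq_zero.mp this with h | h <;> linarith
    have h1 := congrArg f hμ
    simp only [map_sub, map_smul, smul_eq_mul] at h1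
    have h2 := hf z1 hkK
    rw [map_sub] at h2
    rw [hfy] at h1
    have : μ = 1 := by
      have : (μ - 1) * (f z1 - f x) = 0 := by linarith
      rcases mul_eq_zero.mp this with h | h <;> linarith
    rw [this, one_smul] at hμ
    exact hxy (sub_right_injective hμ).symm
  · have h1 : ∀ z ∈ K, ⟪u, y⟫ ≤ ⟪u, z⟫ := by
      intro z hz
      obtain ⟨z', hz', c, hc⟩ := hyx z hz
      have h := hneg z hz
      rw [hc, map_smul, smul_eq_mul] at h
      have hc0 : c ≤ 0 := by
        by_contra hc0
        have := mul_pos (not_le.mp hc0) (hf z' hz')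
        linarith
      have h2 := congrArg (fun v => ⟪u, v⟫) hc
      simp only [inner_sub_right, inner_smul_right] at h2
      have h3 := mul_nonneg_of_nonpos_of_nonpos hc0 (sub_nonpos.mpr (hxs ▸ hPi' z' hz'))
      linarith
    obtain ⟨z, hz, c, hc⟩ := hxy' k hkK
    have hc0 : c ≠ 0 := by
      rintro rfl
      rw [zero_smul, sub_eq_zero] at hc
      exact hx (hc ▸ hkK)
    have h2 := congrArg (fun v => ⟪u, v⟫) hc
    simp only [inner_sub_right, inner_smul_right] at h2
    have h3 : ⟪u, z⟫ = ⟪u, y⟫ := by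
      have : c * (⟪u, z⟫ - ⟪u, y⟫) = 0 := by linarith
      rcases mul_eq_zero.mp this with h | h
      · exact absurd h hc0
      · linarith
    have h4 : ⟪u, z⟫ = t := by
      apply le_antisymm
      · rw [h3, ← hlt]; exact h1 l hlK
      · exact hGa' z hz
    have h5 : z = l := by
      have : z ∈ ({l} : Set (Euc n)) := by rw [← hl]; exact ⟨h4, hz⟩
      exact this
    subst h5
    refine ⟨by linarith, c⁻¹, ?_⟩
    rw [hc, smul_smul, inv_mul_cancel₀ hc0, one_smul]
    abel

/-- In the Setting, with support hyperplanes `Π₁, Π₂` of `K`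
through `x`, parallel support hyperplanes `Γ₁, Γ₂` (with `Γᵢ ≠ Πᵢ`), a point
`x̄ ∈ Π₁ ∩ Π₂ ∩ L` with `x̄ ≠ x`, and contact points `kᵢ = Πᵢ ∩ K`,
`lᵢ = Γᵢ ∩ K`, the segments `[k₁, k₂]` and `[l₁, l₂]` are parallel. -/
theorem stmt_5 (n : ℕ) (hn : 3 ≤ n) (K L : Set (Euc n))
    (hK : IsConvexBody K) (hKs : StrictConvex ℝ K)
    (hL : IsSphereEmbeddingImage (n - 1) L)
    (hcomp : ∃ z ∈ Lᶜ, Bornology.IsBounded (connectedComponentIn Lᶜ z) ∧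
      K ⊆ connectedComponentIn Lᶜ z)
    (hcone : ∀ x ∈ L, ∃ y ∈ L, y ≠ x ∧ ∃ p : Euc n,
      supportCone K y = (fun z => p + z) '' supportCone K x)
    (x y : Euc n) (hxL : x ∈ L) (hyL : y ∈ L) (hxy : y ≠ x)
    (p : Euc n) (hp : supportCone K y = (fun z => p + z) '' supportCone K x)
    -- the support hyperplanes Π₁ = {z | ⟪u₁, z⟫ = s₁}, Π₂ = {z | ⟪u₂, z⟫ = s₂}
    (u₁ u₂ : Euc n) (s₁ s₂ t₁ t₂ : ℝ) (hu₁ : u₁ ≠ 0) (hu₂ : u₂ ≠ 0)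
    (hPi₁ : K ⊆ {z | ⟪u₁, z⟫ ≤ s₁}) (hPi₂ : K ⊆ {z | ⟪u₂, z⟫ ≤ s₂})
    (hPine : ({z | ⟪u₁, z⟫ = s₁} : Set (Euc n)) ≠ {z | ⟪u₂, z⟫ = s₂})
    -- Γᵢ = {z | ⟪uᵢ, z⟫ = tᵢ} is a support hyperplane parallel to Πᵢ, Γᵢ ≠ Πᵢ
    (hGa₁ : K ⊆ {z | ⟪u₁, z⟫ ≤ t₁} ∨ K ⊆ {z | t₁ ≤ ⟪u₁, z⟫})
    (hGa₂ : K ⊆ {z | ⟪u₂, z⟫ ≤ t₂} ∨ K ⊆ {z | t₂ ≤ ⟪u₂, z⟫})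
    (ht₁ : t₁ ≠ s₁) (ht₂ : t₂ ≠ s₂)
    -- x lies on Π₁ ∩ Π₂
    (hxPi₁ : ⟪u₁, x⟫ = s₁) (hxPi₂ : ⟪u₂, x⟫ = s₂)
    -- Π₁ ∩ Π₂ is not a supporting (n-2)-plane of L: there is x̄ ∈ Π₁ ∩ Π₂ ∩ L, x̄ ≠ x
    (xbar : Euc n) (hxbarL : xbar ∈ L) (hxbarPi₁ : ⟪u₁, xbar⟫ = s₁)
    (hxbarPi₂ : ⟪u₂, xbar⟫ = s₂) (hxbarne : xbar ≠ x)
    -- contact points of the hyperplanes with bd K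
    (k₁ k₂ l₁ l₂ : Euc n)
    (hk₁ : {z | ⟪u₁, z⟫ = s₁} ∩ K = {k₁}) (hk₂ : {z | ⟪u₂, z⟫ = s₂} ∩ K = {k₂})
    (hl₁ : {z | ⟪u₁, z⟫ = t₁} ∩ K = {l₁}) (hl₂ : {z | ⟪u₂, z⟫ = t₂} ∩ K = {l₂}) :
    ∃ r : ℝ, l₂ - l₁ = r • (k₂ - k₁) := by
  have hLK : ∀ a ∈ L, a ∉ K := by
    intro a ha haK
    obtain ⟨z, -, -, h⟩ := hcomp
    exact connectedComponentIn_subset _ _ (h haK) ha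
  obtain ⟨ybar, hybL, hyb, q, hq⟩ := hcone xbar hxbarL
  obtain ⟨hy1, a1, ha1⟩ := key_lemma hn hK (hLK x hxL) (hLK y hyL) hxy hp hPi₁ hGa₁ ht₁ hxPi₁ hk₁ hl₁
  obtain ⟨hy2, a2, ha2⟩ := key_lemma hn hK (hLK x hxL) (hLK y hyL) hxy hp hPi₂ hGa₂ ht₂ hxPi₂ hk₂ hl₂
  obtain ⟨hb1, b1, hb1'⟩ := key_lemma hn hK (hLK _ hxbarL) (hLK _ hybL) hyb hq hPi₁ hGa₁ ht₁
    hxbarPi₁ hk₁ hl₁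
  obtain ⟨hb2, b2, hb2'⟩ := key_lemma hn hK (hLK _ hxbarL) (hLK _ hybL) hyb hq hPi₂ hGa₂ ht₂
    hxbarPi₂ hk₂ hl₂
  have hk1m : k₁ ∈ {z | ⟪u₁, z⟫ = s₁} ∩ K := by rw [hk₁]; rfl
  have hk2m : k₂ ∈ {z | ⟪u₂, z⟫ = s₂} ∩ K := by rw [hk₂]; rfl
  have hl1m : l₁ ∈ {z | ⟪u₁, z⟫ = t₁} ∩ K := by rw [hl₁]; rfl
  by_cases hkk : k₁ = k₂
  · have h1 : l₁ ∈ {z | ⟪u₂, z⟫ = t₂} ∩ K := by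
      refine ⟨?_, hl1m.2⟩
      have : ⟪u₂, k₁⟫ = s₂ := hkk ▸ hk2m.1
      simp only [mem_ofPred_eq]
      rw [ha1, inner_add_right, inner_smul_right, inner_sub_right, this, hxPi₂, hy2]
      ring
    rw [hl₂] at h1
    have h2 : l₁ = l₂ := h1
    exact ⟨0, by simp [h2]⟩
  · have hn1 : ⟪u₂, k₁⟫ - s₂ ≠ 0 := by
      intro h
      have : k₁ ∈ ({k₂} : Set (Euc n)) := by
        rw [← hk₂]; exact ⟨sub_eq_zero.mp h, hk1m.2⟩
      exact hkk this
    have hn2 : ⟪u₁, k₂⟫ - s₁ ≠ 0 := by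
      intro h
      have : k₂ ∈ ({k₁} : Set (Euc n)) := by
        rw [← hk₁]; exact ⟨sub_eq_zero.mp h, hk2m.2⟩
      exact hkk (Eq.symm this)
    have e1 := ha1.symm.trans hb1'
    have e2 := ha2.symm.trans hb2'
    have hab1 : a1 = b1 := by
      have h := congrArg (fun v => ⟪u₂, v⟫) e1
      simp only [inner_add_right, inner_smul_right, inner_sub_right, hxPi₂, hxbarPi₂, hy2, hb2] at h
      exact mul_right_cancel₀ hn1 (by linarith)
    have hab2 : a2 = b2 := by
      have h := congrArg (fun v => ⟪u₁, v⟫) e2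
      simp only [inner_add_right, inner_smul_right, inner_sub_right, hxPi₁, hxbarPi₁, hy1, hb1] at h
      exact mul_right_cancel₀ hn2 (by linarith)
    subst hab1 hab2
    have f1 : y - ybar = a1 • (x - xbar) := by
      rw [← sub_eq_zero] at e1 ⊢
      rw [← e1]; module
    have f2 : y - ybar = a2 • (x - xbar) := by
      rw [← sub_eq_zero] at e2 ⊢
      rw [← e2]; module
    have f3 : a1 = a2 := smul_left_injective ℝ (sub_ne_zero.mpr hxbarne.symm) (f1.symm.trans f2)
    subst f3
    refine ⟨a1, ?_⟩
    rw [ha1, ha2]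
    module
end
end
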